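/- arXiv:1302.3257 — 2 statements merged into one kernel-verified Lean document; each statement's English description precedes it below -/
import Mathlib

section
/- For a twisted product Finsler metric F, the nonlinear connection coefficients G̃^a_b := ∂G̃^a/∂ỹ^b are given by: G̃^i_j = G^i_j + C^{ih}_j f f_h F₂², G̃^i_β = −f f^i v_β, G̃^α_j = f^{-1} f_j v^α, and G̃^α_β = G^α_β + f^{-1}( C^{αγ}_β f_γ F₂² + f_j y^j δ^α_β − f^α v_β + f_β v^α + f_γ v^γ δ^α_β ), where G^i_j := ∂G^i/∂y^j and G^α_β := ∂G^α/∂v^β are formed from the spray coefficients of F₁ and F₂ respectively. -/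
open scoped BigOperators

noncomputable section

/-- Partial derivative in the first (base) variable in coordinate direction `i`. -/
def pdx {ι κ : Type*} [Fintype ι] [DecidableEq ι]
    (i : ι) (φ : (ι → ℝ) → (κ → ℝ) → ℝ) (x : ι → ℝ) (y : κ → ℝ) : ℝ :=
  fderiv ℝ (fun x' => φ x' y) x (Pi.single i 1)

/-- Partial derivative in the second (fiber) variable in coordinate direction `j`. -/
def pdy {ι κ : Type*} [Fintype κ] [DecidableEq κ]
    (j : κ) (φ : (ι → ℝ) → (κ → ℝ) → ℝ) (x : ι → ℝ) (y : κ → ℝ) : ℝ :=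
  fderiv ℝ (fun y' => φ x y') y (Pi.single j 1)

variable {ι : Type*} [Fintype ι] [DecidableEq ι]

/-- Fundamental tensor `g_{ij}(x,y) = (1/2) ∂²F²/∂y^i∂y^j`. -/
def fTensor (F : (ι → ℝ) → (ι → ℝ) → ℝ) (i j : ι) (x y : ι → ℝ) : ℝ :=
  (1/2) * pdy i (pdy j (fun a b => (F a b)^2)) x y

/-- Fundamental tensor as a matrix. -/
def gMat (F : (ι → ℝ) → (ι → ℝ) → ℝ) (x y : ι → ℝ) : Matrix ι ι ℝ :=
  Matrix.of fun i j => fTensor F i j x y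

/-- Inverse fundamental tensor `g^{ij}`. -/
def gInv (F : (ι → ℝ) → (ι → ℝ) → ℝ) (x y : ι → ℝ) : Matrix ι ι ℝ :=
  (gMat F x y)⁻¹

/-- `F` is a Finsler metric on the open set `U ⊆ ℝ^ι`. -/
structure IsFinslerMetric (U : Set (ι → ℝ)) (F : (ι → ℝ) → (ι → ℝ) → ℝ) : Prop where
  isOpen : IsOpen U
  nonneg : ∀ x ∈ U, ∀ y : ι → ℝ, 0 ≤ F x y
  smooth : ContDiffOn ℝ (⊤ : ℕ∞) (fun p : (ι → ℝ) × (ι → ℝ) => F p.1 p.2) (U ×ˢ {y : ι → ℝ | y ≠ 0})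
  homog : ∀ x ∈ U, ∀ (y : ι → ℝ) (t : ℝ), 0 < t → F x (t • y) = t * F x y
  posdef : ∀ x ∈ U, ∀ y : ι → ℝ, y ≠ 0 → ∀ w : ι → ℝ, w ≠ 0 →
    0 < ∑ i, ∑ j, fTensor F i j x y * w i * w j

/-- Spray coefficients `G^i = (1/4) g^{il}((∂²F²/∂x^k∂y^l) y^k − ∂F²/∂x^l)`. -/
def sprayCoef (F : (ι → ℝ) → (ι → ℝ) → ℝ) (i : ι) (x y : ι → ℝ) : ℝ :=
  (1/4) * ∑ l, gInv F x y i l *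
    ((∑ k, y k * pdx k (pdy l (fun a b => (F a b)^2)) x y)
      - pdx l (fun a b => (F a b)^2) x y)

/-- Nonlinear connection coefficients `G^a_b = ∂G^a/∂y^b`. -/
def nonlinConn (F : (ι → ℝ) → (ι → ℝ) → ℝ) (a b : ι) (x y : ι → ℝ) : ℝ :=
  pdy b (sprayCoef F a) x y

/-- Cartan tensor `C_{ijk} = (1/2) ∂g_{ij}/∂y^k`. -/
def cartan (F : (ι → ℝ) → (ι → ℝ) → ℝ) (i j k : ι) (x y : ι → ℝ) : ℝ :=
  (1/2) * pdy k (fTensor F i j) x y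

/-- Cartan tensor with first index raised: `C^c_{ab} = g^{ce} C_{abe}`. -/
def cartanUp1 (F : (ι → ℝ) → (ι → ℝ) → ℝ) (c a b : ι) (x y : ι → ℝ) : ℝ :=
  ∑ e, gInv F x y c e * cartan F a b e x y

/-- Cartan tensor with two indices raised: `C^{ih}_j = g^{ir} g^{hs} C_{rsj}`. -/
def cartanUp2 (F : (ι → ℝ) → (ι → ℝ) → ℝ) (i h j : ι) (x y : ι → ℝ) : ℝ :=
  ∑ r, ∑ s, gInv F x y i r * gInv F x y h s * cartan F r s j x y

/-- Mean Cartan torsion `I_a = g^{bc} C_{abc}`. -/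
def meanCartan (F : (ι → ℝ) → (ι → ℝ) → ℝ) (a : ι) (x y : ι → ℝ) : ℝ :=
  ∑ b, ∑ c, gInv F x y b c * cartan F a b c x y

/-- Raised mean Cartan torsion `I^h = g^{hj} I_j`. -/
def meanCartanUp (F : (ι → ℝ) → (ι → ℝ) → ℝ) (h : ι) (x y : ι → ℝ) : ℝ :=
  ∑ j, gInv F x y h j * meanCartan F j x y

/-- `‖I‖² = I^a I_a`. -/
def meanCartanNormSq (F : (ι → ℝ) → (ι → ℝ) → ℝ) (x y : ι → ℝ) : ℝ :=
  ∑ a, ∑ b, gInv F x y a b * meanCartan F a x y * meanCartan F b x y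

/-- Lowered fiber variable `y_a = g_{ab} y^b`. -/
def lowerY (F : (ι → ℝ) → (ι → ℝ) → ℝ) (a : ι) (x y : ι → ℝ) : ℝ :=
  ∑ b, fTensor F a b x y * y b

/-- Angular metric `h_{ab} = g_{ab} − F^{-2} y_a y_b`. -/
def angular (F : (ι → ℝ) → (ι → ℝ) → ℝ) (a b : ι) (x y : ι → ℝ) : ℝ :=
  fTensor F a b x y - ((F x y)^2)⁻¹ * lowerY F a x y * lowerY F b x y

/-- Matsumoto torsion (with `n` the dimension of the underlying manifold). -/
def matsumoto (n : ℕ) (F : (ι → ℝ) → (ι → ℝ) → ℝ) (a b c : ι) (x y : ι → ℝ) : ℝ :=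
  cartan F a b c x y - (1/((n : ℝ)+1)) *
    (meanCartan F a x y * angular F b c x y + meanCartan F b x y * angular F a c x y
      + meanCartan F c x y * angular F a b x y)

/-- Horizontal derivative `δφ/δx^b = ∂φ/∂x^b − G^e_b ∂φ/∂y^e`. -/
def hderiv (F : (ι → ℝ) → (ι → ℝ) → ℝ) (b : ι) (φ : (ι → ℝ) → (ι → ℝ) → ℝ)
    (x y : ι → ℝ) : ℝ :=
  pdx b φ x y - ∑ e, nonlinConn F e b x y * pdy e φ x y

/-- Berwald-type connection coefficients
`F^c_{ab} = (1/2) g^{ce}(δg_{ea}/δx^b + δg_{eb}/δx^a − δg_{ab}/δx^e)`. -/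
def connCoef (F : (ι → ℝ) → (ι → ℝ) → ℝ) (c a b : ι) (x y : ι → ℝ) : ℝ :=
  (1/2) * ∑ e, gInv F x y c e *
    (hderiv F b (fTensor F e a) x y + hderiv F a (fTensor F e b) x y
      - hderiv F e (fTensor F a b) x y)

/-- Riemann curvature of the Berwald connection:
`R^a_{b cd} = δF^a_{bc}/δx^d − δF^a_{bd}/δx^c + F^a_{de} F^e_{bc} − F^a_{ce} F^e_{bd}`. -/
def riemCurv (F : (ι → ℝ) → (ι → ℝ) → ℝ) (a b c d : ι) (x y : ι → ℝ) : ℝ :=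
  hderiv F d (connCoef F a b c) x y - hderiv F c (connCoef F a b d) x y
    + (∑ e, connCoef F a d e x y * connCoef F e b c x y)
    - (∑ e, connCoef F a c e x y * connCoef F e b d x y)

/-- Berwald curvature `B^d_{abc} = ∂³G^d/∂y^a∂y^b∂y^c`. -/
def berwald (F : (ι → ℝ) → (ι → ℝ) → ℝ) (d a b c : ι) (x y : ι → ℝ) : ℝ :=
  pdy a (pdy b (pdy c (sprayCoef F d))) x y

/-- Mean Berwald curvature `E_{ab} = (1/2) B^c_{abc}`. -/
def meanBerwald (F : (ι → ℝ) → (ι → ℝ) → ℝ) (a b : ι) (x y : ι → ℝ) : ℝ :=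
  (1/2) * ∑ c, berwald F c a b c x y

/-- The twisted product metric `F(x,u,y,v) = sqrt(F₁(x,y)² + f(x,u)² F₂(u,v)²)`
on the product, with indices `Fin n₁ ⊕ Fin n₂`. -/
def twisted {n₁ n₂ : ℕ} (F₁ : (Fin n₁ → ℝ) → (Fin n₁ → ℝ) → ℝ)
    (F₂ : (Fin n₂ → ℝ) → (Fin n₂ → ℝ) → ℝ)
    (f : (Fin n₁ → ℝ) → (Fin n₂ → ℝ) → ℝ) :
    ((Fin n₁ ⊕ Fin n₂) → ℝ) → ((Fin n₁ ⊕ Fin n₂) → ℝ) → ℝ :=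
  fun X Y => Real.sqrt ((F₁ (X ∘ Sum.inl) (Y ∘ Sum.inl))^2
    + (f (X ∘ Sum.inl) (X ∘ Sum.inr))^2 * (F₂ (X ∘ Sum.inr) (Y ∘ Sum.inr))^2)

/-- Angular metric with first index raised: `h^d_a = g^{de} h_{ea}`. -/
def angularUp (F : (ι → ℝ) → (ι → ℝ) → ℝ) (d a : ι) (x y : ι → ℝ) : ℝ :=
  ∑ e, gInv F x y d e * angular F e a x y

end

/-- Joint smoothness of a function of two vector variables at a point. -/
def SmAt {ι κ : Type*} [Fintype ι] [Fintype κ] (φ : (ι → ℝ) → (κ → ℝ) → ℝ)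
    (x : ι → ℝ) (y : κ → ℝ) : Prop :=
  ContDiffAt ℝ (⊤ : ℕ∞) (fun p : (ι → ℝ) × (κ → ℝ) => φ p.1 p.2) (x, y)

section aux
set_option linter.unusedSectionVars false
variable {ι κ : Type*} [Fintype ι] [DecidableEq ι] [Fintype κ] [DecidableEq κ]

theorem SmAt.diff {φ : (ι → ℝ) → (κ → ℝ) → ℝ} {x : ι → ℝ} {y : κ → ℝ} (h : SmAt φ x y) :
    DifferentiableAt ℝ (fun p : (ι → ℝ) × (κ → ℝ) => φ p.1 p.2) (x, y) :=
  ContDiffAt.differentiableAt h (by simp)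

theorem SmAt.evdiff {φ : (ι → ℝ) → (κ → ℝ) → ℝ} {x : ι → ℝ} {y : κ → ℝ} (h : SmAt φ x y) :
    ∀ᶠ p in nhds (x, y), DifferentiableAt ℝ (fun p : (ι → ℝ) × (κ → ℝ) => φ p.1 p.2) p := by
  have h1 : ContDiffAt ℝ 1 (fun p : (ι → ℝ) × (κ → ℝ) => φ p.1 p.2) (x, y) :=
    ContDiffAt.of_le h (by exact_mod_cast le_top)
  filter_upwards [h1.eventually (by simp)] with p hp
  exact hp.differentiableAt (by simp)

theorem SmAt.sec_x {φ : (ι → ℝ) → (κ → ℝ) → ℝ} {x : ι → ℝ} {y : κ → ℝ} (h : SmAt φ x y) :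
    ContDiffAt ℝ (⊤ : ℕ∞) (fun x' => φ x' y) x :=
  ContDiffAt.comp x (f := fun x' : ι → ℝ => (x', y)) (n := (⊤ : ℕ∞))
    (g := fun p : (ι → ℝ) × (κ → ℝ) => φ p.1 p.2) h (by fun_prop)

theorem SmAt.sec_y {φ : (ι → ℝ) → (κ → ℝ) → ℝ} {x : ι → ℝ} {y : κ → ℝ} (h : SmAt φ x y) :
    ContDiffAt ℝ (⊤ : ℕ∞) (fun y' => φ x y') y :=
  ContDiffAt.comp y (f := fun y' : κ → ℝ => (x, y')) (n := (⊤ : ℕ∞))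
    (g := fun p : (ι → ℝ) × (κ → ℝ) => φ p.1 p.2) h (by fun_prop)

theorem SmAt.dx {φ : (ι → ℝ) → (κ → ℝ) → ℝ} {x : ι → ℝ} {y : κ → ℝ} (h : SmAt φ x y) :
    DifferentiableAt ℝ (fun x' => φ x' y) x := h.sec_x.differentiableAt (by simp)

theorem SmAt.dy {φ : (ι → ℝ) → (κ → ℝ) → ℝ} {x : ι → ℝ} {y : κ → ℝ} (h : SmAt φ x y) :
    DifferentiableAt ℝ (fun y' => φ x y') y := h.sec_y.differentiableAt (by simp)

theorem pdx_eq_fderiv {φ : (ι → ℝ) → (κ → ℝ) → ℝ} {x : ι → ℝ} {y : κ → ℝ}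
    (h : DifferentiableAt ℝ (fun p : (ι → ℝ) × (κ → ℝ) => φ p.1 p.2) (x, y)) (i : ι) :
    pdx i φ x y = fderiv ℝ (fun p : (ι → ℝ) × (κ → ℝ) => φ p.1 p.2) (x, y) (Pi.single i 1, 0) := by
  have h2 : HasFDerivAt (fun x' : ι → ℝ => (x', y)) (ContinuousLinearMap.inl ℝ (ι → ℝ) (κ → ℝ)) x :=
    hasFDerivAt_prodMk_left x y
  have := HasFDerivAt.comp x (f := fun x' : ι → ℝ => (x', y)) h.hasFDerivAt h2
  unfold pdx
  have e : fderiv ℝ (fun x' => φ x' y) x = _ := this.fderiv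
  rw [e]; simp

theorem pdy_eq_fderiv {φ : (ι → ℝ) → (κ → ℝ) → ℝ} {x : ι → ℝ} {y : κ → ℝ}
    (h : DifferentiableAt ℝ (fun p : (ι → ℝ) × (κ → ℝ) => φ p.1 p.2) (x, y)) (i : κ) :
    pdy i φ x y = fderiv ℝ (fun p : (ι → ℝ) × (κ → ℝ) => φ p.1 p.2) (x, y) (0, Pi.single i 1) := by
  have h2 : HasFDerivAt (fun y' : κ → ℝ => (x, y')) (ContinuousLinearMap.inr ℝ (ι → ℝ) (κ → ℝ)) y :=
    hasFDerivAt_prodMk_right x y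
  have := HasFDerivAt.comp y (f := fun y' : κ → ℝ => (x, y')) h.hasFDerivAt h2
  unfold pdy
  have e : fderiv ℝ (fun y' => φ x y') y = _ := this.fderiv
  rw [e]; simp

theorem SmAt.pdx {φ : (ι → ℝ) → (κ → ℝ) → ℝ} {x : ι → ℝ} {y : κ → ℝ} (h : SmAt φ x y) (i : ι) :
    SmAt (pdx i φ) x y := by
  have h1 : ContDiffAt ℝ (⊤ : ℕ∞) (fun q => fderiv ℝ (fun p : (ι → ℝ) × (κ → ℝ) => φ p.1 p.2) q
      (Pi.single i 1, 0)) (x, y) :=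
    (ContDiffAt.fderiv_right (m := (⊤ : ℕ∞)) h (by simp)).clm_apply contDiffAt_const
  refine h1.congr_of_eventuallyEq ?_
  filter_upwards [h.evdiff] with p hp
  exact pdx_eq_fderiv hp i

theorem SmAt.pdy {φ : (ι → ℝ) → (κ → ℝ) → ℝ} {x : ι → ℝ} {y : κ → ℝ} (h : SmAt φ x y) (i : κ) :
    SmAt (pdy i φ) x y := by
  have h1 : ContDiffAt ℝ (⊤ : ℕ∞) (fun q => fderiv ℝ (fun p : (ι → ℝ) × (κ → ℝ) => φ p.1 p.2) q
      (0, Pi.single i 1)) (x, y) :=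
    (ContDiffAt.fderiv_right (m := (⊤ : ℕ∞)) h (by simp)).clm_apply contDiffAt_const
  refine h1.congr_of_eventuallyEq ?_
  filter_upwards [h.evdiff] with p hp
  exact pdy_eq_fderiv hp i

theorem pdy_congr {φ ψ : (ι → ℝ) → (κ → ℝ) → ℝ} {x : ι → ℝ} {y : κ → ℝ}
    (h : ∀ᶠ y' in nhds y, φ x y' = ψ x y') (j : κ) : pdy j φ x y = pdy j ψ x y := by
  unfold pdy
  rw [Filter.EventuallyEq.fderiv_eq h]

theorem pdx_congr {φ ψ : (ι → ℝ) → (κ → ℝ) → ℝ} {x : ι → ℝ} {y : κ → ℝ}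
    (h : ∀ᶠ x' in nhds x, φ x' y = ψ x' y) (j : ι) : pdx j φ x y = pdx j ψ x y := by
  unfold pdx
  rw [Filter.EventuallyEq.fderiv_eq h]

/-- Splitting the derivative on a sum type. -/
theorem fderiv_split {φ : (ι → ℝ) → (κ → ℝ) → ℝ} {Z : ι ⊕ κ → ℝ}
    (h : DifferentiableAt ℝ (fun p : (ι → ℝ) × (κ → ℝ) => φ p.1 p.2) (Z ∘ Sum.inl, Z ∘ Sum.inr)) :
    (∀ i, fderiv ℝ (fun Z' : ι ⊕ κ → ℝ => φ (Z' ∘ Sum.inl) (Z' ∘ Sum.inr)) Z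
      (Pi.single (Sum.inl i) 1) = pdx i φ (Z ∘ Sum.inl) (Z ∘ Sum.inr)) ∧
    (∀ i, fderiv ℝ (fun Z' : ι ⊕ κ → ℝ => φ (Z' ∘ Sum.inl) (Z' ∘ Sum.inr)) Z
      (Pi.single (Sum.inr i) 1) = pdy i φ (Z ∘ Sum.inl) (Z ∘ Sum.inr)) := by
  let P : (ι ⊕ κ → ℝ) →L[ℝ] (ι → ℝ) × (κ → ℝ) :=
    (ContinuousLinearMap.pi fun i => ContinuousLinearMap.proj (Sum.inl i)).prod
      (ContinuousLinearMap.pi fun i => ContinuousLinearMap.proj (Sum.inr i))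
  have hP : ∀ W, P W = (W ∘ Sum.inl, W ∘ Sum.inr) := fun W => rfl
  have e : fderiv ℝ (fun Z' : ι ⊕ κ → ℝ => φ (Z' ∘ Sum.inl) (Z' ∘ Sum.inr)) Z = _ :=
    (HasFDerivAt.comp Z (f := P) (g := fun p : (ι → ℝ) × (κ → ℝ) => φ p.1 p.2)
      h.hasFDerivAt P.hasFDerivAt).fderiv
  constructor
  · intro i
    rw [e, pdx_eq_fderiv h]
    simp only [ContinuousLinearMap.comp_apply, hP]
    congr 2
    ext k; simp [Pi.single_apply]
  · intro i
    rw [e, pdy_eq_fderiv h]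
    simp only [ContinuousLinearMap.comp_apply, hP]
    congr 2
    ext k; simp [Pi.single_apply]

/-! ### Facts about a single Finsler metric -/

variable {U : Set (ι → ℝ)} {F : (ι → ℝ) → (ι → ℝ) → ℝ}

theorem IsFinslerMetric.smSq (hF : IsFinslerMetric U F) {x y : ι → ℝ} (hx : x ∈ U) (hy : y ≠ 0) :
    SmAt (fun a b => (F a b)^2) x y := by
  have : ContDiffAt ℝ (⊤ : ℕ∞) (fun p : (ι → ℝ) × (ι → ℝ) => F p.1 p.2) (x, y) :=
    hF.smooth.contDiffAt ((hF.isOpen.prod isOpen_ne).mem_nhds ⟨hx, hy⟩)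
  exact this.pow 2

theorem IsFinslerMetric.smT (hF : IsFinslerMetric U F) {x y : ι → ℝ} (hx : x ∈ U) (hy : y ≠ 0)
    (i j : ι) : SmAt (fTensor F i j) x y := by
  have := ((hF.smSq hx hy).pdy j).pdy i
  exact ContDiffAt.mul contDiffAt_const this

theorem IsFinslerMetric.isUnit (hF : IsFinslerMetric U F) {x y : ι → ℝ} (hx : x ∈ U) (hy : y ≠ 0) :
    IsUnit (gMat F x y).det := by
  rw [isUnit_iff_ne_zero]
  intro h0
  obtain ⟨w, hw, hw0⟩ := Matrix.exists_mulVec_eq_zero_iff.mpr h0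
  have := hF.posdef x hx y hy w hw
  have e : ∑ i, ∑ j, fTensor F i j x y * w i * w j = ∑ i, w i * ((gMat F x y).mulVec w) i := by
    simp only [Matrix.mulVec, dotProduct, gMat, Matrix.of_apply, Finset.mul_sum]
    exact Finset.sum_congr rfl fun i _ => Finset.sum_congr rfl fun j _ => by ring
  rw [e, hw0] at this
  simp at this

theorem IsFinslerMetric.symm (hF : IsFinslerMetric U F) {x y : ι → ℝ} (hx : x ∈ U) (hy : y ≠ 0)
    (i j : ι) : fTensor F i j x y = fTensor F j i x y := by
  have h := (hF.smSq hx hy).sec_y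
  have key : ∀ i j : ι, pdy i (pdy j (fun a b => (F a b)^2)) x y =
      fderiv ℝ (fderiv ℝ (fun y' => (F x y')^2)) y (Pi.single i 1) (Pi.single j 1) := by
    intro i j
    have hd : DifferentiableAt ℝ (fderiv ℝ (fun y' => (F x y')^2)) y :=
      (ContDiffAt.fderiv_right (m := (⊤ : ℕ∞)) h (by simp)).differentiableAt (by simp)
    have e := hd.hasFDerivAt.clm_apply (hasFDerivAt_const (Pi.single j (1:ℝ) : ι → ℝ) y)
    have e2 := e.fderiv
    show fderiv ℝ (fun y' => fderiv ℝ (fun y' => (F x y')^2) y' (Pi.single j 1)) y (Pi.single i 1) = _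
    rw [e2]; simp
  unfold fTensor
  rw [key, key]
  have hs : IsSymmSndFDerivAt ℝ (fun y' => (F x y')^2) y :=
    ContDiffAt.isSymmSndFDerivAt h (by
      simp only [minSmoothness_of_isRCLikeNormedField]
      exact WithTop.coe_le_coe.2 (le_top : (2 : ℕ∞) ≤ ⊤))
  rw [hs.eq]

theorem IsFinslerMetric.gInv_symm (hF : IsFinslerMetric U F) {x y : ι → ℝ} (hx : x ∈ U) (hy : y ≠ 0)
    (i j : ι) : gInv F x y i j = gInv F x y j i := by
  have : (gMat F x y).transpose = gMat F x y := by
    ext a b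
    simp only [Matrix.transpose_apply, gMat, Matrix.of_apply]
    exact hF.symm hx hy b a
  have h2 : (gInv F x y).transpose = gInv F x y := by
    unfold gInv
    rw [Matrix.transpose_nonsing_inv, this]
  conv_lhs => rw [← h2]
  rfl

/-- Smoothness of determinants. -/
theorem contDiffAt_det {E : Type*} [NormedAddCommGroup E] [NormedSpace ℝ E]
    {M : E → Matrix ι ι ℝ} {p : E} (h : ∀ i j, ContDiffAt ℝ (⊤ : ℕ∞) (fun q => M q i j) p) :
    ContDiffAt ℝ (⊤ : ℕ∞) (fun q => (M q).det) p := by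
  simp only [Matrix.det_apply, Units.smul_def, zsmul_eq_mul]
  exact ContDiffAt.sum fun σ _ => contDiffAt_const.mul (contDiffAt_prod fun i _ => h _ _)

theorem contDiffAt_inv_entry {E : Type*} [NormedAddCommGroup E] [NormedSpace ℝ E]
    {M : E → Matrix ι ι ℝ} {p : E} (h : ∀ i j, ContDiffAt ℝ (⊤ : ℕ∞) (fun q => M q i j) p)
    (hu : IsUnit (M p).det) (i j : ι) :
    ContDiffAt ℝ (⊤ : ℕ∞) (fun q => (M q)⁻¹ i j) p := by
  simp only [Matrix.inv_def, Ring.inverse_eq_inv', Matrix.smul_apply, smul_eq_mul,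
    Matrix.adjugate_apply]
  refine ((contDiffAt_det h).inv hu.ne_zero).mul (contDiffAt_det fun a b => ?_)
  simp only [Matrix.updateRow_apply]
  split_ifs
  · exact contDiffAt_const
  · exact h a b

theorem IsFinslerMetric.smInv (hF : IsFinslerMetric U F) {x y : ι → ℝ} (hx : x ∈ U) (hy : y ≠ 0)
    (i j : ι) : SmAt (fun a b => gInv F a b i j) x y :=
  contDiffAt_inv_entry (M := fun p : (ι → ℝ) × (ι → ℝ) => gMat F p.1 p.2)
    (fun i j => hF.smT hx hy i j) (hF.isUnit hx hy) i j

theorem IsFinslerMetric.smSpray (hF : IsFinslerMetric U F) {x y : ι → ℝ} (hx : x ∈ U) (hy : y ≠ 0)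
    (i : ι) : SmAt (sprayCoef F i) x y := by
  unfold SmAt sprayCoef
  refine contDiffAt_const.mul (ContDiffAt.sum fun l _ => (hF.smInv hx hy i l).mul
    (ContDiffAt.sub (ContDiffAt.sum fun k _ => ContDiffAt.mul (by fun_prop)
      (((hF.smSq hx hy).pdy l).pdx k)) ((hF.smSq hx hy).pdx l)))

theorem IsFinslerMetric.inv_mul (hF : IsFinslerMetric U F) {x y : ι → ℝ} (hx : x ∈ U) (hy : y ≠ 0) :
    gInv F x y * gMat F x y = 1 := Matrix.nonsing_inv_mul _ (hF.isUnit hx hy)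

theorem IsFinslerMetric.mul_inv (hF : IsFinslerMetric U F) {x y : ι → ℝ} (hx : x ∈ U) (hy : y ≠ 0) :
    gMat F x y * gInv F x y = 1 := Matrix.mul_nonsing_inv _ (hF.isUnit hx hy)

/-- Derivative of the inverse fundamental tensor. -/
theorem IsFinslerMetric.pdy_gInv (hF : IsFinslerMetric U F) {x y : ι → ℝ} (hx : x ∈ U) (hy : y ≠ 0)
    (i h j : ι) : pdy j (fun a b => gInv F a b i h) x y = -2 * cartanUp2 F i h j x y := by
  let A : Matrix ι ι ℝ := Matrix.of fun i h => pdy j (fun a b => gInv F a b i h) x y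
  let B : Matrix ι ι ℝ := Matrix.of fun i h => pdy j (fTensor F i h) x y
  have h0 : gMat F x y * A + B * gInv F x y = 0 := by
    ext r s
    have e : ∀ᶠ y' in nhds y, ∑ k, fTensor F r k x y' * gInv F x y' k s =
        (1 : Matrix ι ι ℝ) r s := by
      filter_upwards [isOpen_ne.eventually_mem hy] with y' hy'
      rw [← hF.mul_inv hx hy', Matrix.mul_apply]; rfl
    have e1 := pdy_congr (φ := fun a b => ∑ k, fTensor F r k a b * gInv F a b k s)
      (ψ := fun _ _ => (1 : Matrix ι ι ℝ) r s) e j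
    have d := HasFDerivAt.fun_sum (u := Finset.univ) (fun k _ => (hF.smT hx hy r k).dy.hasFDerivAt.mul
      (hF.smInv hx hy k s).dy.hasFDerivAt)
    have e2 : pdy j (fun a b => ∑ k, fTensor F r k a b * gInv F a b k s) x y = _ :=
      congrArg (fun L => L (Pi.single j 1)) d.fderiv
    rw [e2] at e1
    simp only [Matrix.add_apply, Matrix.mul_apply, Matrix.zero_apply, ← Finset.sum_add_distrib]
    have e3 : pdy j (fun (_ _ : ι → ℝ) => (1 : Matrix ι ι ℝ) r s) x y = 0 := by
      simp [pdy]
    rw [e3] at e1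
    rw [← e1]
    simp only [_root_.sum_apply]
    refine Finset.sum_congr rfl fun k _ => ?_
    simp [A, B, gMat, pdy, mul_comm]
  have h1 : A = - (gInv F x y * B * gInv F x y) := by
    have := congrArg (fun M => gInv F x y * M) h0
    simp only [Matrix.mul_add, ← Matrix.mul_assoc, hF.inv_mul hx hy, Matrix.one_mul,
      Matrix.mul_zero] at this
    exact eq_neg_of_add_eq_zero_left this
  have h2 := congrFun (congrFun h1 i) h
  have h3 : pdy j (fun a b => gInv F a b i h) x y = A i h := rfl
  rw [h3, h2, cartanUp2, Matrix.neg_apply, Matrix.mul_apply, Finset.mul_sum, ← Finset.sum_neg_distrib]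
  simp only [Matrix.mul_apply, Finset.sum_mul, Finset.mul_sum, ← Finset.sum_neg_distrib]
  rw [Finset.sum_comm]
  refine Finset.sum_congr rfl fun r _ => Finset.sum_congr rfl fun s _ => ?_
  simp only [cartan, B, Matrix.of_apply]
  rw [hF.gInv_symm hx hy h s]
  ring

theorem sum_pdy (φ : (ι → ℝ) → (κ → ℝ) → ℝ) (x : ι → ℝ) (y w : κ → ℝ) :
    ∑ b, pdy b φ x y * w b = fderiv ℝ (fun y' => φ x y') y w := by
  conv_rhs => rw [pi_eq_sum_univ' w]
  simp only [map_sum, map_smul, smul_eq_mul, pdy]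
  refine Finset.sum_congr rfl fun b _ => ?_
  rw [mul_comm]

theorem IsFinslerMetric.euler (hF : IsFinslerMetric U F) {x y : ι → ℝ} (hx : x ∈ U) (hy : y ≠ 0) :
    ∑ b, pdy b (fun a b => (F a b)^2) x y * y b = 2 * (F x y)^2 := by
  rw [sum_pdy]
  have hd : DifferentiableAt ℝ (fun y' => (F x y')^2) ((1:ℝ) • y) := by
    rw [one_smul]; exact (hF.smSq hx hy).dy
  have h1 : HasDerivAt (fun t : ℝ => t • y) y 1 := by
    simpa using (hasDerivAt_id (1:ℝ)).smul_const y
  have h2 := hd.hasFDerivAt.comp_hasDerivAt (1:ℝ) h1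
  rw [one_smul] at h2
  have h3 : HasDerivAt (fun t : ℝ => t^2 * (F x y)^2) (2 * (F x y)^2) 1 := by
    simpa using (hasDerivAt_pow 2 (1:ℝ)).mul_const ((F x y)^2)
  refine (h2.congr_of_eventuallyEq ?_).unique h3
  filter_upwards [lt_mem_nhds (zero_lt_one (α := ℝ))] with t ht
  simp only [Function.comp]
  rw [hF.homog x hx y t ht]; ring

theorem IsFinslerMetric.pdy_sq (hF : IsFinslerMetric U F) {x y : ι → ℝ} (hx : x ∈ U) (hy : y ≠ 0)
    (a : ι) : pdy a (fun a b => (F a b)^2) x y = 2 * lowerY F a x y := by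
  have e : ∀ᶠ y' in nhds y, ∑ b, pdy b (fun a b => (F a b)^2) x y' * y' b = 2 * (F x y')^2 := by
    filter_upwards [isOpen_ne.eventually_mem hy] with y' hy'
    exact hF.euler hx hy'
  have e1 := pdy_congr (φ := fun x y => ∑ b, pdy b (fun a b => (F a b)^2) x y * y b)
      (ψ := fun x y => 2 * (F x y)^2) e a
  have hap : ∀ k : ι, HasFDerivAt (fun y' : ι → ℝ => y' k)
      (ContinuousLinearMap.proj (R := ℝ) (φ := fun _ => ℝ) k) y := fun k => hasFDerivAt_apply k y
  have d := HasFDerivAt.fun_sum (u := Finset.univ) (fun k _ =>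
    ((hF.smSq hx hy).pdy k).dy.hasFDerivAt.mul (hap k))
  have e2 : pdy a (fun x y => ∑ b, pdy b (fun a b => (F a b)^2) x y * y b) x y = _ :=
    congrArg (fun L => L (Pi.single a 1)) d.fderiv
  have e3 : pdy a (fun x y => 2 * (F x y)^2) x y = _ :=
    congrArg (fun L => L (Pi.single a 1)) ((hF.smSq hx hy).dy.hasFDerivAt.const_mul 2).fderiv
  rw [e2, e3] at e1
  simp only [_root_.sum_apply, _root_.add_apply,
    _root_.smul_apply, smul_eq_mul, Finset.sum_add_distrib,
    ContinuousLinearMap.proj_apply] at e1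
  have e4 : ∑ b, pdy b (fun a b => (F a b)^2) x y * (Pi.single a 1 : ι → ℝ) b =
      pdy a (fun a b => (F a b)^2) x y := by
    simp [Pi.single_apply]
  rw [e4] at e1
  have e5 : ∑ b, y b * fderiv ℝ (fun y' => pdy b (fun a b => (F a b)^2) x y') y (Pi.single a 1) =
      2 * lowerY F a x y := by
    rw [lowerY, Finset.mul_sum]
    refine Finset.sum_congr rfl fun b _ => ?_
    rw [fTensor]
    show y b * pdy a (pdy b (fun a b => (F a b)^2)) x y = _
    ring
  rw [e5] at e1
  have e6 : fderiv ℝ (fun y' => (F x y')^2) y (Pi.single a 1) =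
    pdy a (fun a b => (F a b)^2) x y := rfl
  rw [e6] at e1
  linarith

/-- Raising the lowered fiber variable. -/
theorem IsFinslerMetric.raise (hF : IsFinslerMetric U F) {x y : ι → ℝ} (hx : x ∈ U) (hy : y ≠ 0)
    (a : ι) : ∑ c, gInv F x y a c * lowerY F c x y = y a := by
  have h : (gInv F x y).mulVec ((gMat F x y).mulVec y) = y := by
    rw [Matrix.mulVec_mulVec, hF.inv_mul hx hy, Matrix.one_mulVec]
  exact congrFun h a

end aux

section tw
variable {n₁ n₂ : ℕ} {U₁ : Set (Fin n₁ → ℝ)} {U₂ : Set (Fin n₂ → ℝ)}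
    {F₁ : (Fin n₁ → ℝ) → (Fin n₁ → ℝ) → ℝ}
    {F₂ : (Fin n₂ → ℝ) → (Fin n₂ → ℝ) → ℝ}
    {f : (Fin n₁ → ℝ) → (Fin n₂ → ℝ) → ℝ}

theorem tw_sq : (fun a b => (twisted F₁ F₂ f a b)^2) =
    fun X Y => (F₁ (X ∘ Sum.inl) (Y ∘ Sum.inl))^2
      + (f (X ∘ Sum.inl) (X ∘ Sum.inr))^2 * (F₂ (X ∘ Sum.inr) (Y ∘ Sum.inr))^2 := by
  funext X Y
  exact Real.sq_sqrt (by positivity)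

theorem ev_mem {s : Set (Fin n₁ → ℝ)} {t : Set (Fin n₂ → ℝ)} (hs : IsOpen s) (ht : IsOpen t)
    {X : Fin n₁ ⊕ Fin n₂ → ℝ} (h1 : X ∘ Sum.inl ∈ s) (h2 : X ∘ Sum.inr ∈ t) :
    ∀ᶠ X' in nhds X, X' ∘ Sum.inl ∈ s ∧ X' ∘ Sum.inr ∈ t := by
  have c1 : Continuous (fun X' : Fin n₁ ⊕ Fin n₂ → ℝ => X' ∘ Sum.inl) :=
    continuous_pi fun i => continuous_apply _
  have c2 : Continuous (fun X' : Fin n₁ ⊕ Fin n₂ → ℝ => X' ∘ Sum.inr) :=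
    continuous_pi fun i => continuous_apply _
  exact ((hs.preimage c1).eventually_mem h1).and ((ht.preimage c2).eventually_mem h2)

theorem dfst {a : Fin n₁ → ℝ} {b : Fin n₂ → ℝ} {g : (Fin n₁ → ℝ) → ℝ}
    (h : DifferentiableAt ℝ g a) :
    DifferentiableAt ℝ (fun p : (Fin n₁ → ℝ) × (Fin n₂ → ℝ) => g p.1) (a, b) :=
  DifferentiableAt.comp (a, b) (f := Prod.fst) (g := g) h differentiableAt_fst

theorem dsnd {a : Fin n₁ → ℝ} {b : Fin n₂ → ℝ} {g : (Fin n₂ → ℝ) → ℝ}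
    (h : DifferentiableAt ℝ g b) :
    DifferentiableAt ℝ (fun p : (Fin n₁ → ℝ) × (Fin n₂ → ℝ) => g p.2) (a, b) :=
  DifferentiableAt.comp (a, b) (f := Prod.snd) (g := g) h differentiableAt_snd

theorem tw_pdy (hF₁ : IsFinslerMetric U₁ F₁) (hF₂ : IsFinslerMetric U₂ F₂)
    {X Y : Fin n₁ ⊕ Fin n₂ → ℝ} (h1 : X ∘ Sum.inl ∈ U₁) (h2 : X ∘ Sum.inr ∈ U₂)
    (h3 : Y ∘ Sum.inl ≠ 0) (h4 : Y ∘ Sum.inr ≠ 0) :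
    (∀ i, pdy (Sum.inl i) (fun a b => (twisted F₁ F₂ f a b)^2) X Y =
      pdy i (fun a b => (F₁ a b)^2) (X ∘ Sum.inl) (Y ∘ Sum.inl)) ∧
    (∀ i, pdy (Sum.inr i) (fun a b => (twisted F₁ F₂ f a b)^2) X Y =
      (f (X ∘ Sum.inl) (X ∘ Sum.inr))^2 *
        pdy i (fun a b => (F₂ a b)^2) (X ∘ Sum.inr) (Y ∘ Sum.inr)) := by
  rw [tw_sq]
  have d1 := (hF₁.smSq h1 h3).dy
  have d2 := (hF₂.smSq h2 h4).dy
  have key := fderiv_split (Z := Y) (φ := fun a b => (F₁ (X ∘ Sum.inl) a)^2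
      + (f (X ∘ Sum.inl) (X ∘ Sum.inr))^2 * (F₂ (X ∘ Sum.inr) b)^2)
      ((dfst d1).add ((dsnd d2).const_mul _))
  refine ⟨fun i => (key.1 i).trans ?_, fun i => (key.2 i).trans ?_⟩
  · simp only [pdx, pdy]
    rw [fderiv_add_const]
  · simp only [pdy]
    rw [fderiv_const_add, fderiv_const_mul d2]
    rfl

theorem tw_fT (hF₁ : IsFinslerMetric U₁ F₁) (hF₂ : IsFinslerMetric U₂ F₂)
    {X Y : Fin n₁ ⊕ Fin n₂ → ℝ} (h1 : X ∘ Sum.inl ∈ U₁) (h2 : X ∘ Sum.inr ∈ U₂)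
    (h3 : Y ∘ Sum.inl ≠ 0) (h4 : Y ∘ Sum.inr ≠ 0) :
    gMat (twisted F₁ F₂ f) X Y = Matrix.fromBlocks (gMat F₁ (X ∘ Sum.inl) (Y ∘ Sum.inl)) 0 0
      ((f (X ∘ Sum.inl) (X ∘ Sum.inr))^2 • gMat F₂ (X ∘ Sum.inr) (Y ∘ Sum.inr)) := by
  have ev := ev_mem isOpen_ne isOpen_ne h3 h4
  have e1 : ∀ j, ∀ᶠ Y' in nhds Y, pdy (Sum.inl j) (fun a b => (twisted F₁ F₂ f a b)^2) X Y' =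
      pdy j (fun a b => (F₁ a b)^2) (X ∘ Sum.inl) (Y' ∘ Sum.inl) := fun j => by
    filter_upwards [ev] with Y' hY'
    exact (tw_pdy hF₁ hF₂ h1 h2 hY'.1 hY'.2).1 j
  have e2 : ∀ j, ∀ᶠ Y' in nhds Y, pdy (Sum.inr j) (fun a b => (twisted F₁ F₂ f a b)^2) X Y' =
      (f (X ∘ Sum.inl) (X ∘ Sum.inr))^2 *
        pdy j (fun a b => (F₂ a b)^2) (X ∘ Sum.inr) (Y' ∘ Sum.inr) := fun j => by
    filter_upwards [ev] with Y' hY'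
    exact (tw_pdy hF₁ hF₂ h1 h2 hY'.1 hY'.2).2 j
  have d1 := fun j => ((hF₁.smSq h1 h3).pdy j).dy
  have d2 := fun j => ((hF₂.smSq h2 h4).pdy j).dy
  have k1 := fun j => fderiv_split (Z := Y) (φ := fun a (b : Fin n₂ → ℝ) =>
    pdy j (fun a b => (F₁ a b)^2) (X ∘ Sum.inl) a) (dfst (d1 j))
  have k2 := fun j => fderiv_split (Z := Y) (φ := fun (a : Fin n₁ → ℝ) b =>
    (f (X ∘ Sum.inl) (X ∘ Sum.inr))^2 * pdy j (fun a b => (F₂ a b)^2) (X ∘ Sum.inr) b)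
    ((dsnd (d2 j)).const_mul _)
  ext a b
  rcases a with a | a <;> rcases b with b | b <;>
    simp only [gMat, Matrix.of_apply, fTensor, Matrix.fromBlocks_apply₁₁,
      Matrix.fromBlocks_apply₁₂, Matrix.fromBlocks_apply₂₁, Matrix.fromBlocks_apply₂₂,
      Matrix.zero_apply, Matrix.smul_apply, smul_eq_mul]
  · rw [pdy_congr (ψ := fun X Y => pdy b (fun a b => (F₁ a b)^2) (X ∘ Sum.inl) (Y ∘ Sum.inl)) (e1 b)]
    congr 1
    exact (k1 b).1 a
  · rw [pdy_congr (ψ := fun X Y => (f (X ∘ Sum.inl) (X ∘ Sum.inr))^2 *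
      pdy b (fun a b => (F₂ a b)^2) (X ∘ Sum.inr) (Y ∘ Sum.inr)) (e2 b)]
    rw [show pdy (Sum.inl a) (fun X Y => (f (X ∘ Sum.inl) (X ∘ Sum.inr))^2 *
      pdy b (fun a b => (F₂ a b)^2) (X ∘ Sum.inr) (Y ∘ Sum.inr)) X Y = _ from (k2 b).1 a]
    simp [pdx]
  · rw [pdy_congr (ψ := fun X Y => pdy b (fun a b => (F₁ a b)^2) (X ∘ Sum.inl) (Y ∘ Sum.inl)) (e1 b)]
    rw [show pdy (Sum.inr a) (fun X Y => pdy b (fun a b => (F₁ a b)^2) (X ∘ Sum.inl)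
      (Y ∘ Sum.inl)) X Y = _ from (k1 b).2 a]
    simp [pdy]
  · rw [pdy_congr (ψ := fun X Y => (f (X ∘ Sum.inl) (X ∘ Sum.inr))^2 *
      pdy b (fun a b => (F₂ a b)^2) (X ∘ Sum.inr) (Y ∘ Sum.inr)) (e2 b)]
    rw [show pdy (Sum.inr a) (fun X Y => (f (X ∘ Sum.inl) (X ∘ Sum.inr))^2 *
      pdy b (fun a b => (F₂ a b)^2) (X ∘ Sum.inr) (Y ∘ Sum.inr)) X Y = _ from (k2 b).2 a]
    have := congrArg (fun L => L (Pi.single a 1))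
      (fderiv_const_mul (d2 b) ((f (X ∘ Sum.inl) (X ∘ Sum.inr))^2))
    rw [show pdy a (fun (_ : Fin n₁ → ℝ) b_1 => (f (X ∘ Sum.inl) (X ∘ Sum.inr))^2 *
      pdy b (fun a b => (F₂ a b)^2) (X ∘ Sum.inr) b_1) (Y ∘ Sum.inl) (Y ∘ Sum.inr) = _ from this]
    simp only [_root_.smul_apply, smul_eq_mul]
    rw [show fderiv ℝ (fun y' => pdy b (fun a b => (F₂ a b)^2) (X ∘ Sum.inr) y') (Y ∘ Sum.inr)
      (Pi.single a 1) = pdy a (pdy b (fun a b => (F₂ a b)^2)) (X ∘ Sum.inr) (Y ∘ Sum.inr) from rfl]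
    ring

theorem tw_gInv (hF₁ : IsFinslerMetric U₁ F₁) (hF₂ : IsFinslerMetric U₂ F₂)
    {X Y : Fin n₁ ⊕ Fin n₂ → ℝ} (h1 : X ∘ Sum.inl ∈ U₁) (h2 : X ∘ Sum.inr ∈ U₂)
    (h3 : Y ∘ Sum.inl ≠ 0) (h4 : Y ∘ Sum.inr ≠ 0)
    (hp : f (X ∘ Sum.inl) (X ∘ Sum.inr) ≠ 0) :
    gInv (twisted F₁ F₂ f) X Y = Matrix.fromBlocks (gInv F₁ (X ∘ Sum.inl) (Y ∘ Sum.inl)) 0 0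
      (((f (X ∘ Sum.inl) (X ∘ Sum.inr))^2)⁻¹ • gInv F₂ (X ∘ Sum.inr) (Y ∘ Sum.inr)) := by
  unfold gInv
  rw [tw_fT hF₁ hF₂ h1 h2 h3 h4]
  refine Matrix.inv_eq_right_inv ?_
  rw [Matrix.fromBlocks_multiply]
  have a1 := hF₁.mul_inv h1 h3
  have a2 := hF₂.mul_inv h2 h4
  unfold gInv at a1 a2
  simp only [a1, a2, Matrix.mul_zero, Matrix.zero_mul, add_zero, zero_add, Matrix.smul_mul,
    Matrix.mul_smul, smul_smul]
  rw [inv_mul_cancel₀ (pow_ne_zero 2 hp), one_smul, smul_zero, Matrix.fromBlocks_one]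

/-- Derivatives of `A(a) + f(a,b)² B(b)`. -/
theorem split_aux {A : (Fin n₁ → ℝ) → ℝ} {B : (Fin n₂ → ℝ) → ℝ} {X : Fin n₁ ⊕ Fin n₂ → ℝ}
    (hA : DifferentiableAt ℝ A (X ∘ Sum.inl)) (hB : DifferentiableAt ℝ B (X ∘ Sum.inr))
    (hf : SmAt f (X ∘ Sum.inl) (X ∘ Sum.inr)) :
    (∀ k, fderiv ℝ (fun X' : Fin n₁ ⊕ Fin n₂ → ℝ => A (X' ∘ Sum.inl) +
        (f (X' ∘ Sum.inl) (X' ∘ Sum.inr))^2 * B (X' ∘ Sum.inr)) X (Pi.single (Sum.inl k) 1) =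
      fderiv ℝ A (X ∘ Sum.inl) (Pi.single k 1) + 2 * f (X ∘ Sum.inl) (X ∘ Sum.inr) *
        pdx k f (X ∘ Sum.inl) (X ∘ Sum.inr) * B (X ∘ Sum.inr)) ∧
    (∀ k, fderiv ℝ (fun X' : Fin n₁ ⊕ Fin n₂ → ℝ => A (X' ∘ Sum.inl) +
        (f (X' ∘ Sum.inl) (X' ∘ Sum.inr))^2 * B (X' ∘ Sum.inr)) X (Pi.single (Sum.inr k) 1) =
      2 * f (X ∘ Sum.inl) (X ∘ Sum.inr) *
        pdy k f (X ∘ Sum.inl) (X ∘ Sum.inr) * B (X ∘ Sum.inr) +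
      (f (X ∘ Sum.inl) (X ∘ Sum.inr))^2 * fderiv ℝ B (X ∘ Sum.inr) (Pi.single k 1)) := by
  have key := fderiv_split (Z := X) (φ := fun a b => A a + (f a b)^2 * B b)
    ((dfst hA).add ((hf.diff.pow 2).mul (dsnd hB)))
  refine ⟨fun k => (key.1 k).trans ?_, fun k => (key.2 k).trans ?_⟩
  · have d := hA.hasFDerivAt.add ((hf.dx.hasFDerivAt.pow 2).mul_const (B (X ∘ Sum.inr)))
    have e : pdx k (fun a b => A a + (f a b)^2 * B b) (X ∘ Sum.inl) (X ∘ Sum.inr) = _ :=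
      congrArg (fun L => L (Pi.single k 1)) d.fderiv
    rw [e]
    simp [pdx]
    ring
  · have d := ((hf.dy.hasFDerivAt.pow 2).mul hB.hasFDerivAt).const_add (A (X ∘ Sum.inl))
    have e : pdy k (fun a b => A a + (f a b)^2 * B b) (X ∘ Sum.inl) (X ∘ Sum.inr) = _ :=
      congrArg (fun L => L (Pi.single k 1)) d.fderiv
    rw [e]
    simp [pdy]
    ring

theorem tw_spray (hF₁ : IsFinslerMetric U₁ F₁) (hF₂ : IsFinslerMetric U₂ F₂)
    {X Y : Fin n₁ ⊕ Fin n₂ → ℝ} {x y : Fin n₁ → ℝ} {u v : Fin n₂ → ℝ}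
    (hX1 : X ∘ Sum.inl = x) (hX2 : X ∘ Sum.inr = u) (hY1 : Y ∘ Sum.inl = y) (hY2 : Y ∘ Sum.inr = v)
    (h1 : x ∈ U₁) (h2 : u ∈ U₂) (h3 : y ≠ 0) (h4 : v ≠ 0)
    (hf : SmAt f x u) (hp : f x u ≠ 0) :
    (∀ i, sprayCoef (twisted F₁ F₂ f) (Sum.inl i) X Y = sprayCoef F₁ i x y -
      (1/2) * f x u * (∑ h, gInv F₁ x y i h * pdx h f x u) * (F₂ u v)^2) ∧
    (∀ i, sprayCoef (twisted F₁ F₂ f) (Sum.inr i) X Y = sprayCoef F₂ i u v +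
      (f x u)⁻¹ * ((∑ j, pdx j f x u * y j) * v i + (∑ γ, pdy γ f x u * v γ) * v i -
      (1/2) * (∑ γ, gInv F₂ u v i γ * pdy γ f x u) * (F₂ u v)^2)) := by
  subst hX1 hX2 hY1 hY2
  have ev := ev_mem hF₁.isOpen hF₂.isOpen h1 h2
  have c1 : ∀ l, ∀ᶠ X' in nhds X, pdy (Sum.inl l) (fun a b => (twisted F₁ F₂ f a b)^2) X' Y =
      pdy l (fun a b => (F₁ a b)^2) (X' ∘ Sum.inl) (Y ∘ Sum.inl) +
      (f (X' ∘ Sum.inl) (X' ∘ Sum.inr))^2 * 0 := fun l => by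
    filter_upwards [ev] with X' hX'
    rw [mul_zero, add_zero]
    exact (tw_pdy hF₁ hF₂ hX'.1 hX'.2 h3 h4).1 l
  have c2 : ∀ l, ∀ᶠ X' in nhds X, pdy (Sum.inr l) (fun a b => (twisted F₁ F₂ f a b)^2) X' Y =
      0 + (f (X' ∘ Sum.inl) (X' ∘ Sum.inr))^2 *
        pdy l (fun a b => (F₂ a b)^2) (X' ∘ Sum.inr) (Y ∘ Sum.inr) := fun l => by
    filter_upwards [ev] with X' hX'
    rw [zero_add]
    exact (tw_pdy hF₁ hF₂ hX'.1 hX'.2 h3 h4).2 l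
  have s1 := fun l => split_aux (A := fun a => pdy l (fun a b => (F₁ a b)^2) a (Y ∘ Sum.inl))
    (B := fun _ => 0) ((hF₁.smSq h1 h3).pdy l).dx (differentiableAt_const _) hf
  have s2 := fun l => split_aux (A := fun _ => 0)
    (B := fun b => pdy l (fun a b => (F₂ a b)^2) b (Y ∘ Sum.inr))
    (differentiableAt_const _) ((hF₂.smSq h2 h4).pdy l).dx hf
  have s0 := split_aux (A := fun a => (F₁ a (Y ∘ Sum.inl))^2)
    (B := fun b => (F₂ b (Y ∘ Sum.inr))^2)
    (hF₁.smSq h1 h3).dx (hF₂.smSq h2 h4).dx hf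
  have p11 : ∀ k l, pdx (Sum.inl k) (pdy (Sum.inl l) (fun a b => (twisted F₁ F₂ f a b)^2)) X Y =
      pdx k (pdy l (fun a b => (F₁ a b)^2)) (X ∘ Sum.inl) (Y ∘ Sum.inl) := fun k l => by
    rw [pdx, Filter.EventuallyEq.fderiv_eq (c1 l), (s1 l).1 k, mul_zero, add_zero]; rfl
  have p21 : ∀ k l, pdx (Sum.inr k) (pdy (Sum.inl l) (fun a b => (twisted F₁ F₂ f a b)^2)) X Y =
      0 := fun k l => by
    rw [pdx, Filter.EventuallyEq.fderiv_eq (c1 l), (s1 l).2 k]; simp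
  have p12 : ∀ k l, pdx (Sum.inl k) (pdy (Sum.inr l) (fun a b => (twisted F₁ F₂ f a b)^2)) X Y =
      2 * f (X ∘ Sum.inl) (X ∘ Sum.inr) * pdx k f (X ∘ Sum.inl) (X ∘ Sum.inr) *
        (2 * lowerY F₂ l (X ∘ Sum.inr) (Y ∘ Sum.inr)) := fun k l => by
    rw [pdx, Filter.EventuallyEq.fderiv_eq (c2 l), (s2 l).1 k, hF₂.pdy_sq h2 h4]; simp
  have p22 : ∀ k l, pdx (Sum.inr k) (pdy (Sum.inr l) (fun a b => (twisted F₁ F₂ f a b)^2)) X Y =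
      2 * f (X ∘ Sum.inl) (X ∘ Sum.inr) * pdy k f (X ∘ Sum.inl) (X ∘ Sum.inr) *
        (2 * lowerY F₂ l (X ∘ Sum.inr) (Y ∘ Sum.inr)) +
      (f (X ∘ Sum.inl) (X ∘ Sum.inr))^2 *
        pdx k (pdy l (fun a b => (F₂ a b)^2)) (X ∘ Sum.inr) (Y ∘ Sum.inr) := fun k l => by
    rw [pdx, Filter.EventuallyEq.fderiv_eq (c2 l), (s2 l).2 k, hF₂.pdy_sq h2 h4]; rfl
  have q1 : ∀ k, pdx (Sum.inl k) (fun a b => (twisted F₁ F₂ f a b)^2) X Y =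
      pdx k (fun a b => (F₁ a b)^2) (X ∘ Sum.inl) (Y ∘ Sum.inl) +
      2 * f (X ∘ Sum.inl) (X ∘ Sum.inr) * pdx k f (X ∘ Sum.inl) (X ∘ Sum.inr) *
        (F₂ (X ∘ Sum.inr) (Y ∘ Sum.inr))^2 := fun k => by
    rw [tw_sq]; exact s0.1 k
  have q2 : ∀ k, pdx (Sum.inr k) (fun a b => (twisted F₁ F₂ f a b)^2) X Y =
      2 * f (X ∘ Sum.inl) (X ∘ Sum.inr) * pdy k f (X ∘ Sum.inl) (X ∘ Sum.inr) *
        (F₂ (X ∘ Sum.inr) (Y ∘ Sum.inr))^2 + (f (X ∘ Sum.inl) (X ∘ Sum.inr))^2 *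
      pdx k (fun a b => (F₂ a b)^2) (X ∘ Sum.inr) (Y ∘ Sum.inr) := fun k => by
    rw [tw_sq]; exact s0.2 k
  have r := fun i => hF₂.raise h2 h4 i
  have gi := tw_gInv hF₁ hF₂ h1 h2 h3 h4 hp
  generalize hc : f (X ∘ Sum.inl) (X ∘ Sum.inr) = c at *
  constructor
  · intro i
    rw [sprayCoef, sprayCoef, gi]
    simp only [Fintype.sum_sum_type, Matrix.fromBlocks_apply₁₁, Matrix.fromBlocks_apply₁₂,
      Matrix.zero_apply, zero_mul, Finset.sum_const_zero, add_zero, p11, p21, q1, mul_zero]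
    rw [Finset.mul_sum, Finset.mul_sum, Finset.mul_sum, Finset.sum_mul, ← Finset.sum_sub_distrib]
    refine Finset.sum_congr rfl fun l _ => ?_
    simp only [Function.comp_apply]
    ring
  · intro i
    rw [sprayCoef, sprayCoef, gi]
    simp only [Fintype.sum_sum_type, Matrix.fromBlocks_apply₂₁, Matrix.fromBlocks_apply₂₂,
      Matrix.zero_apply, zero_mul, Finset.sum_const_zero, zero_add, p12, p22, q2,
      Matrix.smul_apply, smul_eq_mul]
    have ri : (Y ∘ Sum.inr) i = _ := (r i).symm
    rw [ri]
    rw [← add_mul, Finset.mul_sum, Finset.mul_sum, Finset.mul_sum, Finset.mul_sum, Finset.sum_mul,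
      ← Finset.sum_sub_distrib, Finset.mul_sum, ← Finset.sum_add_distrib]
    refine Finset.sum_congr rfl fun l _ => ?_
    have t1 : ∑ k, Y (Sum.inl k) * (2 * c * pdx k f (X ∘ Sum.inl) (X ∘ Sum.inr) *
        (2 * lowerY F₂ l (X ∘ Sum.inr) (Y ∘ Sum.inr))) =
        4 * c * lowerY F₂ l (X ∘ Sum.inr) (Y ∘ Sum.inr) *
          ∑ k, pdx k f (X ∘ Sum.inl) (X ∘ Sum.inr) * (Y ∘ Sum.inl) k := by
      rw [Finset.mul_sum]
      refine Finset.sum_congr rfl fun k _ => ?_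
      simp only [Function.comp_apply]
      ring
    have t2 : ∑ k, Y (Sum.inr k) * (2 * c * pdy k f (X ∘ Sum.inl) (X ∘ Sum.inr) *
        (2 * lowerY F₂ l (X ∘ Sum.inr) (Y ∘ Sum.inr)) +
        c^2 * pdx k (pdy l (fun a b => (F₂ a b)^2)) (X ∘ Sum.inr) (Y ∘ Sum.inr)) =
        4 * c * lowerY F₂ l (X ∘ Sum.inr) (Y ∘ Sum.inr) *
          ∑ k, pdy k f (X ∘ Sum.inl) (X ∘ Sum.inr) * (Y ∘ Sum.inr) k +
        c^2 * ∑ k, (Y ∘ Sum.inr) k *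
          pdx k (pdy l (fun a b => (F₂ a b)^2)) (X ∘ Sum.inr) (Y ∘ Sum.inr) := by
      rw [Finset.mul_sum, Finset.mul_sum, ← Finset.sum_add_distrib]
      refine Finset.sum_congr rfl fun k _ => ?_
      simp only [Function.comp_apply]
      ring
    rw [t1, t2]
    field_simp
    ring

end tw

theorem stmt_2 {n₁ n₂ : ℕ} {U₁ : Set (Fin n₁ → ℝ)} {U₂ : Set (Fin n₂ → ℝ)}
    {F₁ : (Fin n₁ → ℝ) → (Fin n₁ → ℝ) → ℝ}
    {F₂ : (Fin n₂ → ℝ) → (Fin n₂ → ℝ) → ℝ}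
    {f : (Fin n₁ → ℝ) → (Fin n₂ → ℝ) → ℝ}
    (hF₁ : IsFinslerMetric U₁ F₁) (hF₂ : IsFinslerMetric U₂ F₂)
    (hf : ContDiffOn ℝ (⊤ : ℕ∞) (fun p : (Fin n₁ → ℝ) × (Fin n₂ → ℝ) => f p.1 p.2) (U₁ ×ˢ U₂))
    (hfpos : ∀ x ∈ U₁, ∀ u ∈ U₂, 0 < f x u)
 :
    ∀ x ∈ U₁, ∀ u ∈ U₂, ∀ (y : Fin n₁ → ℝ) (v : Fin n₂ → ℝ), y ≠ 0 → v ≠ 0 →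
      (∀ i j : Fin n₁,
        nonlinConn (twisted F₁ F₂ f) (Sum.inl i) (Sum.inl j) (Sum.elim x u) (Sum.elim y v)
          = nonlinConn F₁ i j x y
            + (∑ h, cartanUp2 F₁ i h j x y * pdx h f x u) * f x u * (F₂ u v)^2)
      ∧ (∀ (i : Fin n₁) (β : Fin n₂),
        nonlinConn (twisted F₁ F₂ f) (Sum.inl i) (Sum.inr β) (Sum.elim x u) (Sum.elim y v)
          = - (f x u * (∑ h, gInv F₁ x y i h * pdx h f x u) * lowerY F₂ β u v))
      ∧ (∀ (α : Fin n₂) (j : Fin n₁),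
        nonlinConn (twisted F₁ F₂ f) (Sum.inr α) (Sum.inl j) (Sum.elim x u) (Sum.elim y v)
          = (f x u)⁻¹ * pdx j f x u * v α)
      ∧ (∀ α β : Fin n₂,
        nonlinConn (twisted F₁ F₂ f) (Sum.inr α) (Sum.inr β) (Sum.elim x u) (Sum.elim y v)
          = nonlinConn F₂ α β u v
            + (f x u)⁻¹ * ((∑ γ, cartanUp2 F₂ α γ β u v * pdy γ f x u) * (F₂ u v)^2
              + (∑ j, pdx j f x u * y j) * (if α = β then (1:ℝ) else 0)
              - (∑ γ, gInv F₂ u v α γ * pdy γ f x u) * lowerY F₂ β u v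
              + pdy β f x u * v α
              + (∑ γ, pdy γ f x u * v γ) * (if α = β then (1:ℝ) else 0))) := by
  intro x hx u hu y v hy hv
  have hfs : SmAt f x u := hf.contDiffAt ((hF₁.isOpen.prod hF₂.isOpen).mem_nhds ⟨hx, hu⟩)
  have hp : f x u ≠ 0 := (hfpos x hx u hu).ne'
  have ev := ev_mem (X := Sum.elim y v) (s := {a | a ≠ 0}) (t := {a | a ≠ 0}) isOpen_ne isOpen_ne
    (by simpa using hy) (by simpa using hv)
  let φ : Fin n₁ → (Fin n₁ → ℝ) → (Fin n₂ → ℝ) → ℝ := fun i a b => sprayCoef F₁ i x a -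
    (1/2) * f x u * (∑ h, gInv F₁ x a i h * pdx h f x u) * (F₂ u b)^2
  let ψ : Fin n₂ → (Fin n₁ → ℝ) → (Fin n₂ → ℝ) → ℝ := fun i a b => sprayCoef F₂ i u b +
      (f x u)⁻¹ * ((∑ j, pdx j f x u * a j) * b i + (∑ γ, pdy γ f x u * b γ) * b i -
      (1/2) * (∑ γ, gInv F₂ u b i γ * pdy γ f x u) * (F₂ u b)^2)
  have hG1 := fun i => (hF₁.smSpray hx hy i).dy
  have hG2 := fun i => (hF₂.smSpray hu hv i).dy
  have hI1 := fun i j => (hF₁.smInv hx hy i j).dy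
  have hI2 := fun i j => (hF₂.smInv hu hv i j).dy
  have hE2 := (hF₂.smSq hu hv).dy
  have hS1 : ∀ i, HasFDerivAt (fun a => ∑ h, gInv F₁ x a i h * pdx h f x u) _ y := fun i =>
    HasFDerivAt.fun_sum (u := Finset.univ) (fun h _ => (hI1 i h).hasFDerivAt.mul_const (pdx h f x u))
  have hS2 : ∀ i, HasFDerivAt (fun a => ∑ h, gInv F₂ u a i h * pdy h f x u) _ v := fun i =>
    HasFDerivAt.fun_sum (u := Finset.univ) (fun h _ => (hI2 i h).hasFDerivAt.mul_const (pdy h f x u))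
  have hap1 : ∀ k, HasFDerivAt (fun y' : Fin n₁ → ℝ => y' k)
      (ContinuousLinearMap.proj (R := ℝ) (φ := fun _ => ℝ) k) y := fun k => hasFDerivAt_apply k y
  have hap2 : ∀ k, HasFDerivAt (fun y' : Fin n₂ → ℝ => y' k)
      (ContinuousLinearMap.proj (R := ℝ) (φ := fun _ => ℝ) k) v := fun k => hasFDerivAt_apply k v
  have hL1 : HasFDerivAt (fun a : Fin n₁ → ℝ => ∑ j, pdx j f x u * a j) _ y :=
    HasFDerivAt.fun_sum (u := Finset.univ) (fun h _ => (hap1 h).const_mul (pdx h f x u))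
  have hL2 : HasFDerivAt (fun a : Fin n₂ → ℝ => ∑ j, pdy j f x u * a j) _ v :=
    HasFDerivAt.fun_sum (u := Finset.univ) (fun h _ => (hap2 h).const_mul (pdy h f x u))
  have dφ : ∀ i, DifferentiableAt ℝ (fun p : (Fin n₁ → ℝ) × (Fin n₂ → ℝ) => φ i p.1 p.2) (y, v) :=
    fun i => (dfst (hG1 i)).sub (((dfst (hS1 i).differentiableAt).const_mul _).mul (dsnd hE2))
  have dψ : ∀ i, DifferentiableAt ℝ (fun p : (Fin n₁ → ℝ) × (Fin n₂ → ℝ) => ψ i p.1 p.2) (y, v) :=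
    fun i => (dsnd (hG2 i)).add (((((dfst hL1.differentiableAt).mul
      (dsnd (hap2 i).differentiableAt)).add ((dsnd hL2.differentiableAt).mul
      (dsnd (hap2 i).differentiableAt))).sub
      (((dsnd (hS2 i).differentiableAt).const_mul _).mul (dsnd hE2))).const_mul _)
  have c1 : ∀ i, ∀ᶠ Y in nhds (Sum.elim y v), sprayCoef (twisted F₁ F₂ f) (Sum.inl i)
      (Sum.elim x u) Y = φ i (Y ∘ Sum.inl) (Y ∘ Sum.inr) := fun i => by
    filter_upwards [ev] with Y hY
    exact (tw_spray hF₁ hF₂ (Sum.elim_comp_inl x u) (Sum.elim_comp_inr x u) rfl rfl hx hu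
      hY.1 hY.2 hfs hp).1 i
  have c2 : ∀ i, ∀ᶠ Y in nhds (Sum.elim y v), sprayCoef (twisted F₁ F₂ f) (Sum.inr i)
      (Sum.elim x u) Y = ψ i (Y ∘ Sum.inl) (Y ∘ Sum.inr) := fun i => by
    filter_upwards [ev] with Y hY
    exact (tw_spray hF₁ hF₂ (Sum.elim_comp_inl x u) (Sum.elim_comp_inr x u) rfl rfl hx hu
      hY.1 hY.2 hfs hp).2 i
  have k1 := fun i => fderiv_split (Z := Sum.elim y v) (φ := φ i)
    (by rw [Sum.elim_comp_inl, Sum.elim_comp_inr]; exact dφ i)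
  have k2 := fun i => fderiv_split (Z := Sum.elim y v) (φ := ψ i)
    (by rw [Sum.elim_comp_inl, Sum.elim_comp_inr]; exact dψ i)
  simp only [Sum.elim_comp_inl, Sum.elim_comp_inr] at k1 k2
  have hCart1 : ∀ i h j, fderiv ℝ (fun y' => gInv F₁ x y' i h) y (Pi.single j 1) =
      -2 * cartanUp2 F₁ i h j x y := fun i h j => hF₁.pdy_gInv hx hy i h j
  have hCart2 : ∀ i h j, fderiv ℝ (fun y' => gInv F₂ u y' i h) v (Pi.single j 1) =
      -2 * cartanUp2 F₂ i h j u v := fun i h j => hF₂.pdy_gInv hu hv i h j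
  have hLow : ∀ j, fderiv ℝ (fun y' => (F₂ u y')^2) v (Pi.single j 1) = 2 * lowerY F₂ j u v :=
    fun j => hF₂.pdy_sq hu hv j
  refine ⟨fun i j => ?_, fun i β => ?_, fun α j => ?_, fun α β => ?_⟩
  · rw [nonlinConn, pdy, Filter.EventuallyEq.fderiv_eq (c1 i), (k1 i).1 j]
    have e : pdx j (φ i) y v = _ := congrArg (fun L => L (Pi.single j 1))
      ((hG1 i).hasFDerivAt.sub (((hS1 i).const_mul ((1/2) * f x u)).mul_const ((F₂ u v)^2))).fderiv
    rw [e]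
    simp only [_root_.sub_apply, _root_.smul_apply, _root_.sum_apply, smul_eq_mul, hCart1]
    rw [show fderiv ℝ (fun y' => sprayCoef F₁ i x y') y (Pi.single j 1) = nonlinConn F₁ i j x y
      from rfl]
    have : ∑ h, pdx h f x u * (-2 * cartanUp2 F₁ i h j x y) =
        -2 * ∑ h, cartanUp2 F₁ i h j x y * pdx h f x u := by
      rw [Finset.mul_sum]
      exact Finset.sum_congr rfl fun h _ => by ring
    rw [this]
    ring
  · rw [nonlinConn, pdy, Filter.EventuallyEq.fderiv_eq (c1 i), (k1 i).2 β]
    have e : pdy β (φ i) y v = _ := congrArg (fun L => L (Pi.single β 1))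
      ((hE2.hasFDerivAt.const_mul ((1/2) * f x u *
        (∑ h, gInv F₁ x y i h * pdx h f x u))).const_sub (sprayCoef F₁ i x y)).fderiv
    rw [e]
    simp only [_root_.neg_apply, _root_.smul_apply, smul_eq_mul, hLow]
    ring
  · rw [nonlinConn, pdy, Filter.EventuallyEq.fderiv_eq (c2 α), (k2 α).1 j]
    have e : pdx j (ψ α) y v = _ := congrArg (fun L => L (Pi.single j 1))
      (((((hL1.mul_const (v α)).add_const ((∑ γ, pdy γ f x u * v γ) * v α)).sub_const
        ((1/2) * (∑ γ, gInv F₂ u v α γ * pdy γ f x u) * (F₂ u v)^2)).const_mul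
        ((f x u)⁻¹)).const_add (sprayCoef F₂ α u v)).fderiv
    rw [e]
    simp only [_root_.smul_apply, _root_.sum_apply, smul_eq_mul, ContinuousLinearMap.proj_apply]
    simp [Pi.single_apply]
    ring
  · rw [nonlinConn, pdy, Filter.EventuallyEq.fderiv_eq (c2 α), (k2 α).2 β]
    have e : pdy β (ψ α) y v = _ := congrArg (fun L => L (Pi.single β 1))
      ((hG2 α).hasFDerivAt.add (((((hap2 α).const_mul (∑ j, pdx j f x u * y j)).add
        (hL2.mul (hap2 α))).sub
        (((hS2 α).const_mul (1/2)).mul hE2.hasFDerivAt)).const_mul ((f x u)⁻¹))).fderiv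
    rw [e]
    simp only [_root_.sub_apply, _root_.add_apply, _root_.smul_apply, _root_.sum_apply, smul_eq_mul,
      hCart2, hLow, ContinuousLinearMap.proj_apply]
    rw [show fderiv ℝ (fun y' => sprayCoef F₂ α u y') v (Pi.single β 1) = nonlinConn F₂ α β u v
      from rfl]
    have : ∑ h, pdy h f x u * (-2 * cartanUp2 F₂ α h β u v) =
        -2 * ∑ h, cartanUp2 F₂ α h β u v * pdy h f x u := by
      rw [Finset.mul_sum]
      exact Finset.sum_congr rfl fun h _ => by ring
    rw [this]
    have t : ∑ h, pdy h f x u * (Pi.single β 1 : Fin n₂ → ℝ) h = pdy β f x u := by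
      simp [Pi.single_apply]
    rw [t, Pi.single_apply]
    ring
end

section
/- The Berwald curvature B̃^d_{abc} := ∂³G̃^d/∂ỹ^a∂ỹ^b∂ỹ^c of a twisted product Finsler metric F has components: B̃^k_{ijl} = B^k_{ijl} + f C^{kh}_{l;j;i} f_h F₂², B̃^k_{iβl} = 2 f C^{kh}_{i;l} f_h v_β, B̃^k_{αβl} = 2 f g_{αβ} C^{kh}_l f_h, B̃^k_{αβλ} = −2 f C_{αβλ} f^k, B̃^γ_{iβλ} = B̃^γ_{ijλ} = B̃^γ_{ijk} = 0, and B̃^γ_{αβλ} = B^γ_{αβλ} + f^{-1}( C^{γν}_{λ;α;β} f_ν F₂² + 2 C^{γν}_{α;β} f_ν v_λ + 2 C^{γν}_{α;λ} f_ν v_β + 2 C^{γν}_α f_ν g_{λβ} + 2 C^{γν}_{λ;β} f_ν v_α + 2 C^{γν}_β f_ν g_{λα} + 2 C^{γν}_λ f_ν g_{αβ} − 2 C_{αβλ} f^γ ), where B^k_{ijl} and B^γ_{αβλ} are the Berwald curvatures of F₁ and F₂. -/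
open scoped BigOperators

namespace TW

open Set

set_option linter.unusedSectionVars false

/-- Partial derivative of a function of one vector variable. -/
noncomputable def D {κ : Type*} [Fintype κ] [DecidableEq κ] (j : κ) (φ : (κ → ℝ) → ℝ) (y : κ → ℝ) : ℝ :=
  fderiv ℝ φ y (Pi.single j 1)

/-- Smoothness on a set. -/
abbrev Sm {E : Type*} [NormedAddCommGroup E] [NormedSpace ℝ E] (S : Set E) (φ : E → ℝ) : Prop :=
  ContDiffOn ℝ (⊤ : ℕ∞) φ S

section calcs
variable {κ : Type*} [Fintype κ] [DecidableEq κ] {S : Set (κ → ℝ)}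

theorem Sm.diff {E : Type*} [NormedAddCommGroup E] [NormedSpace ℝ E] {S : Set E} (hS : IsOpen S)
    {φ : E → ℝ} (h : Sm S φ) {y : E} (hy : y ∈ S) : DifferentiableAt ℝ φ y :=
  (h.contDiffAt (hS.mem_nhds hy)).differentiableAt (by simp)

theorem Sm.fd {E : Type*} [NormedAddCommGroup E] [NormedSpace ℝ E] {S : Set E} (hS : IsOpen S)
    {φ : E → ℝ} (h : Sm S φ) (e : E) : Sm S (fun y => fderiv ℝ φ y e) := by
  have := h.fderiv_of_isOpen hS (m := ((⊤ : ℕ∞) : WithTop ℕ∞)) (by norm_cast)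
  exact this.clm_apply contDiffOn_const

theorem Sm.D (hS : IsOpen S) {φ : (κ → ℝ) → ℝ} (h : Sm S φ) (j : κ) : Sm S (D j φ) :=
  Sm.fd hS h _

theorem D_congr (hS : IsOpen S) {φ ψ : (κ → ℝ) → ℝ} (h : EqOn φ ψ S) (j : κ) :
    EqOn (D j φ) (D j ψ) S := by
  intro y hy
  have : φ =ᶠ[nhds y] ψ := Filter.eventuallyEq_of_mem (hS.mem_nhds hy) h
  simp only [D, this.fderiv_eq]

theorem D_const (c : ℝ) (j : κ) : D j (fun _ => c) = fun _ => 0 := by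
  funext y; simp [D]

theorem D_coord (j a : κ) : D j (fun y => y a) = fun _ => (Pi.single j (1 : ℝ) : κ → ℝ) a := by
  funext y
  have : HasFDerivAt (fun y : κ → ℝ => y a) (ContinuousLinearMap.proj (R := ℝ) (φ := fun _ => ℝ) a) y :=
    (ContinuousLinearMap.proj (R := ℝ) (φ := fun _ : κ => ℝ) a).hasFDerivAt
  simp [D, this.fderiv]

theorem sm_coord (a : κ) : Sm S (fun y : κ → ℝ => y a) := by
  have : ContDiff ℝ (⊤ : ℕ∞) (fun y : κ → ℝ => y a) := by fun_prop
  exact this.contDiffOn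

theorem D_add (hS : IsOpen S) {φ ψ : (κ → ℝ) → ℝ} (h : Sm S φ) (h' : Sm S ψ) (j : κ) :
    EqOn (D j (fun y => φ y + ψ y)) (fun y => D j φ y + D j ψ y) S := by
  intro y hy
  simp only [D]
  rw [fderiv_fun_add (h.diff hS hy) (h'.diff hS hy)]; rfl

theorem D_mul (hS : IsOpen S) {φ ψ : (κ → ℝ) → ℝ} (h : Sm S φ) (h' : Sm S ψ) (j : κ) :
    EqOn (D j (fun y => φ y * ψ y)) (fun y => D j φ y * ψ y + φ y * D j ψ y) S := by
  intro y hy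
  simp only [D]
  rw [fderiv_fun_mul (h.diff hS hy) (h'.diff hS hy)]
  simp; ring

theorem D_lin (hS : IsOpen S) {τ : Type*} [Fintype τ] {A : τ → (κ → ℝ) → ℝ} (h : ∀ t, Sm S (A t))
    (c : τ → ℝ) (j : κ) :
    EqOn (D j (fun y => ∑ t, A t y * c t)) (fun y => ∑ t, D j (A t) y * c t) S := by
  intro y hy
  simp only [D]
  rw [fderiv_fun_sum (fun t _ => ((h t).diff hS hy).mul_const (c t))]
  simp only [sum_apply]
  refine Finset.sum_congr rfl fun t _ => ?_
  rw [fderiv_mul_const ((h t).diff hS hy)]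
  simp; ring

theorem D_sum (hS : IsOpen S) {τ : Type*} [Fintype τ] {A : τ → (κ → ℝ) → ℝ} (h : ∀ t, Sm S (A t))
    (j : κ) :
    EqOn (D j (fun y => ∑ t, A t y)) (fun y => ∑ t, D j (A t) y) S := by
  intro y hy
  simpa using D_lin hS h (fun _ => 1) j hy

theorem D_mulc (hS : IsOpen S) {A : (κ → ℝ) → ℝ} (h : Sm S A) (c : ℝ) (j : κ) :
    EqOn (D j (fun y => c * A y)) (fun y => c * D j A y) S := by
  intro y hy
  simp only [D]
  rw [fderiv_const_mul (h.diff hS hy)]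
  simp

theorem sm_sum {E : Type*} [NormedAddCommGroup E] [NormedSpace ℝ E] {S : Set E} {τ : Type*}
    [Fintype τ] {A : τ → E → ℝ} (h : ∀ t, Sm S (A t)) : Sm S (fun y => ∑ t, A t y) :=
  ContDiffOn.sum fun t _ => h t

theorem sm_lin {E : Type*} [NormedAddCommGroup E] [NormedSpace ℝ E] {S : Set E} {τ : Type*}
    [Fintype τ] {A : τ → E → ℝ} (h : ∀ t, Sm S (A t)) (c : τ → ℝ) :
    Sm S (fun y => ∑ t, A t y * c t) :=
  ContDiffOn.sum fun t _ => (h t).mul contDiffOn_const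

theorem D_comm (hS : IsOpen S) {φ : (κ → ℝ) → ℝ} (h : Sm S φ) (i j : κ) :
    EqOn (D i (D j φ)) (D j (D i φ)) S := by
  intro y hy
  have h1 : ContDiffAt ℝ (⊤ : ℕ∞) φ y := h.contDiffAt (hS.mem_nhds hy)
  have hd : DifferentiableAt ℝ (fderiv ℝ φ) y :=
    (h1.fderiv_right (m := ((⊤ : ℕ∞) : WithTop ℕ∞)) (by norm_cast)).differentiableAt (by simp)
  have key : ∀ a b : κ, D a (D b φ) y = fderiv ℝ (fderiv ℝ φ) y (Pi.single a 1) (Pi.single b 1) := by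
    intro a b
    change fderiv ℝ (fun y => fderiv ℝ φ y (Pi.single b 1)) y (Pi.single a 1) = _
    rw [fderiv_clm_apply hd (differentiableAt_const _)]
    simp
  rw [key, key]
  have := h1.isSymmSndFDerivAt (by simpa using (WithTop.coe_le_coe.2 (le_top : (2:ℕ∞) ≤ ⊤)))
  exact this _ _

theorem D3_mul (hS : IsOpen S) {A B : (κ → ℝ) → ℝ} (hA : Sm S A) (hB : Sm S B) (a b c : κ) :
    EqOn (D a (D b (D c (fun y => A y * B y)))) (fun y =>
      (D a (D b (D c A)) y * B y + D b (D c A) y * D a B y)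
      + (D a (D c A) y * D b B y + D c A y * D a (D b B) y)
      + ((D a (D b A) y * D c B y + D b A y * D a (D c B) y)
      + (D a A y * D b (D c B) y + A y * D a (D b (D c B)) y))) S := by
  have e1 := D_mul hS hA hB c
  have e2 := (D_congr hS e1 b).trans
    (D_add hS ((hA.D hS c).mul hB) (hA.mul (hB.D hS c)) b)
  have e3 : EqOn (D b (D c (fun y => A y * B y))) (fun y =>
      (D b (D c A) y * B y + D c A y * D b B y) + (D b A y * D c B y + A y * D b (D c B) y)) S := by
    intro y hy
    have := e2 hy
    simp only at this
    rw [this, D_mul hS (hA.D hS c) hB b hy, D_mul hS hA (hB.D hS c) b hy]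
  have s1 := ((hA.D hS c).D hS b).mul hB
  have s2 := (hA.D hS c).mul (hB.D hS b)
  have s3 := (hA.D hS b).mul (hB.D hS c)
  have s4 := hA.mul ((hB.D hS c).D hS b)
  intro y hy
  rw [D_congr hS e3 a hy, D_add hS (s1.add s2) (s3.add s4) a hy]
  simp only
  rw [D_add hS s1 s2 a hy, D_add hS s3 s4 a hy]
  simp only
  rw [D_mul hS ((hA.D hS c).D hS b) hB a hy, D_mul hS (hA.D hS c) (hB.D hS b) a hy,
    D_mul hS (hA.D hS b) (hB.D hS c) a hy, D_mul hS hA ((hB.D hS c).D hS b) a hy]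

end calcs

section fin
variable {κ : Type*} [Fintype κ] [DecidableEq κ]

theorem sm_det {E : Type*} [NormedAddCommGroup E] [NormedSpace ℝ E] {S : Set E}
    {M : E → Matrix κ κ ℝ} (h : ∀ i j, Sm S (fun y => M y i j)) : Sm S (fun y => (M y).det) := by
  simp only [Matrix.det_apply]
  refine ContDiffOn.sum fun σ _ => ?_
  exact (contDiffOn_prod fun i _ => h (σ i) i).const_smul _

theorem sm_inv {E : Type*} [NormedAddCommGroup E] [NormedSpace ℝ E] {S : Set E}
    {M : E → Matrix κ κ ℝ} (h : ∀ i j, Sm S (fun y => M y i j)) (h0 : ∀ y ∈ S, (M y).det ≠ 0)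
    (i j : κ) : Sm S (fun y => (M y)⁻¹ i j) := by
  have : (fun y => (M y)⁻¹ i j) = fun y => ((M y).det)⁻¹ * (M y).adjugate i j := by
    funext y; simp [Matrix.inv_def, Ring.inverse_eq_inv']
  rw [this]
  refine ((sm_det h).inv h0).mul ?_
  simp only [Matrix.adjugate_apply]
  refine sm_det fun a b => ?_
  by_cases hj : a = j
  · subst hj; simp only [Matrix.updateRow_self]; exact contDiffOn_const
  · simp only [Matrix.updateRow_ne hj]; exact h a b

/-- The slit space. -/
def slit (κ : Type*) : Set (κ → ℝ) := {y | y ≠ 0}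

theorem slit_open : IsOpen (slit κ) := isOpen_ne

variable {U : Set (κ → ℝ)} {F : (κ → ℝ) → (κ → ℝ) → ℝ}

/-- Square of the metric. -/
noncomputable def Lq (F : (κ → ℝ) → (κ → ℝ) → ℝ) (x y : κ → ℝ) : ℝ := (F x y) ^ 2

variable {κ' : Type*} [Fintype κ'] [DecidableEq κ']

theorem fib {S : Set (κ → ℝ)} {T : Set (κ' → ℝ)} {φ : (κ → ℝ) → (κ' → ℝ) → ℝ}
    (h : Sm (S ×ˢ T) (fun p : (κ → ℝ) × (κ' → ℝ) => φ p.1 p.2)) {x} (hx : x ∈ S) :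
    Sm T (φ x) := by
  have : ContDiffOn ℝ (⊤ : ℕ∞) (fun y : κ' → ℝ => (x, y)) T := by fun_prop
  exact h.comp this (fun y hy => ⟨hx, hy⟩)

theorem bas {S : Set (κ → ℝ)} {T : Set (κ' → ℝ)} {φ : (κ → ℝ) → (κ' → ℝ) → ℝ}
    (h : Sm (S ×ˢ T) (fun p : (κ → ℝ) × (κ' → ℝ) => φ p.1 p.2)) {y} (hy : y ∈ T) :
    Sm S (fun x => φ x y) := by
  have : ContDiffOn ℝ (⊤ : ℕ∞) (fun x : κ → ℝ => (x, y)) S := by fun_prop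
  exact h.comp this (fun x hx => ⟨hx, hy⟩)

theorem sm_pdy {S : Set (κ → ℝ)} {T : Set (κ' → ℝ)} (hS : IsOpen S) (hT : IsOpen T)
    {φ : (κ → ℝ) → (κ' → ℝ) → ℝ}
    (h : Sm (S ×ˢ T) (fun p : (κ → ℝ) × (κ' → ℝ) => φ p.1 p.2)) (j : κ') :
    Sm (S ×ˢ T) (fun p : (κ → ℝ) × (κ' → ℝ) => pdy j φ p.1 p.2) := by
  refine (h.fd (hS.prod hT) (0, Pi.single j 1)).congr ?_
  rintro ⟨x, y⟩ hp
  have h1 := (h.diff (hS.prod hT) hp).hasFDerivAt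
  have h2 : HasFDerivAt (fun y' : κ' → ℝ => (x, y')) (ContinuousLinearMap.inr ℝ (κ → ℝ) (κ' → ℝ)) y :=
    hasFDerivAt_prodMk_right x y
  have h3 := HasFDerivAt.comp y h1 h2
  have h4 : fderiv ℝ (fun y' => φ x y') y = _ := h3.fderiv
  simp [pdy, h4]

theorem sm_pdx {S : Set (κ → ℝ)} {T : Set (κ' → ℝ)} (hS : IsOpen S) (hT : IsOpen T)
    {φ : (κ → ℝ) → (κ' → ℝ) → ℝ}
    (h : Sm (S ×ˢ T) (fun p : (κ → ℝ) × (κ' → ℝ) => φ p.1 p.2)) (j : κ) :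
    Sm (S ×ˢ T) (fun p : (κ → ℝ) × (κ' → ℝ) => pdx j φ p.1 p.2) := by
  refine (h.fd (hS.prod hT) (Pi.single j 1, 0)).congr ?_
  rintro ⟨x, y⟩ hp
  have h1 := (h.diff (hS.prod hT) hp).hasFDerivAt
  have h2 : HasFDerivAt (fun x' : κ → ℝ => (x', y)) (ContinuousLinearMap.inl ℝ (κ → ℝ) (κ' → ℝ)) x :=
    hasFDerivAt_prodMk_left x y
  have h3 := HasFDerivAt.comp x h1 h2
  have h4 : fderiv ℝ (fun x' => φ x' y) x = _ := h3.fderiv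
  simp [pdx, h4]

theorem sm_L (hF : IsFinslerMetric U F) :
    Sm (U ×ˢ slit κ) (fun p : (κ → ℝ) × (κ → ℝ) => Lq F p.1 p.2) :=
  hF.smooth.pow 2

theorem sm_Lf (hF : IsFinslerMetric U F) {x} (hx : x ∈ U) : Sm (slit κ) (Lq F x) :=
  fib (sm_L hF) hx

theorem fT_eq (i j : κ) (x : κ → ℝ) : fTensor F i j x = fun y => (1/2) * D i (D j (Lq F x)) y := rfl

theorem sm_fT (hF : IsFinslerMetric U F) {x} (hx : x ∈ U) (i j : κ) : Sm (slit κ) (fTensor F i j x) := by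
  rw [fT_eq]
  exact contDiffOn_const.mul (((sm_Lf hF hx).D slit_open j).D slit_open i)

theorem fT_symm (hF : IsFinslerMetric U F) {x} (hx : x ∈ U) {y} (hy : y ∈ slit κ) (i j : κ) :
    fTensor F i j x y = fTensor F j i x y := by
  simp only [fT_eq]
  rw [D_comm slit_open (sm_Lf hF hx) i j hy]

theorem g_det (hF : IsFinslerMetric U F) {x} (hx : x ∈ U) {y} (hy : y ∈ slit κ) :
    (gMat F x y).det ≠ 0 := by
  intro h
  obtain ⟨w, hw, h0⟩ := Matrix.exists_mulVec_eq_zero_iff.mpr h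
  have := hF.posdef x hx y hy w hw
  have e : ∑ i, ∑ j, fTensor F i j x y * w i * w j = ∑ i, w i * (gMat F x y).mulVec w i := by
    refine Finset.sum_congr rfl fun i _ => ?_
    simp only [Matrix.mulVec, dotProduct, Finset.mul_sum, gMat, Matrix.of_apply]
    exact Finset.sum_congr rfl fun j _ => by ring
  rw [e, h0] at this
  simp at this

theorem sm_gI (hF : IsFinslerMetric U F) {x} (hx : x ∈ U) (i j : κ) :
    Sm (slit κ) (fun y => gInv F x y i j) :=
  sm_inv (fun a b => sm_fT hF hx a b) (fun _ hy => g_det hF hx hy) i j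

theorem gI_symm (hF : IsFinslerMetric U F) {x} (hx : x ∈ U) {y} (hy : y ∈ slit κ) (i j : κ) :
    gInv F x y i j = gInv F x y j i := by
  have : (gMat F x y).transpose = gMat F x y := by
    ext a b; exact fT_symm hF hx hy b a
  have h2 : (gInv F x y).transpose = gInv F x y := by
    rw [gInv, Matrix.transpose_nonsing_inv, this]
  exact congrFun (congrFun h2 j) i

theorem gI_mul (hF : IsFinslerMetric U F) {x} (hx : x ∈ U) {y} (hy : y ∈ slit κ) (i j : κ) :
    ∑ r, gInv F x y i r * fTensor F r j x y = (1 : Matrix κ κ ℝ) i j := by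
  rw [← Matrix.nonsing_inv_mul (gMat F x y) (g_det hF hx hy).isUnit, Matrix.mul_apply]; rfl

theorem gI_mul' (hF : IsFinslerMetric U F) {x} (hx : x ∈ U) {y} (hy : y ∈ slit κ) (i j : κ) :
    ∑ r, fTensor F i r x y * gInv F x y r j = (1 : Matrix κ κ ℝ) i j := by
  rw [← Matrix.mul_nonsing_inv (gMat F x y) (g_det hF hx hy).isUnit, Matrix.mul_apply]; rfl

theorem sm_cartan (hF : IsFinslerMetric U F) {x} (hx : x ∈ U) (i j k : κ) :
    Sm (slit κ) (cartan F i j k x) :=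
  contDiffOn_const.mul ((sm_fT hF hx i j).D slit_open k)

theorem sm_C2 (hF : IsFinslerMetric U F) {x} (hx : x ∈ U) (i j k : κ) :
    Sm (slit κ) (cartanUp2 F i j k x) :=
  sm_sum fun r => sm_sum fun s => ((sm_gI hF hx i r).mul (sm_gI hF hx j s)).mul (sm_cartan hF hx r s k)

theorem D_gI (hF : IsFinslerMetric U F) {x} (hx : x ∈ U) (k h l : κ) :
    EqOn (D l (fun y => gInv F x y k h)) (fun y => -2 * cartanUp2 F k h l x y) (slit κ) := by
  intro y hy
  have e1 : ∀ s, ∑ r, (D l (fun y => gInv F x y k r) y * fTensor F r s x y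
      + gInv F x y k r * D l (fTensor F r s x) y) = 0 := by
    intro s
    have h1 : EqOn (fun y => ∑ r, gInv F x y k r * fTensor F r s x y)
        (fun _ => (1 : Matrix κ κ ℝ) k s) (slit κ) := fun z hz => gI_mul hF hx hz k s
    have h2 := D_congr slit_open h1 l hy
    rw [D_const, D_sum slit_open (fun r => (sm_gI hF hx k r).mul (sm_fT hF hx r s)) l hy] at h2
    refine Eq.trans ?_ h2
    refine Finset.sum_congr rfl fun r _ => ?_
    exact (D_mul slit_open (sm_gI hF hx k r) (sm_fT hF hx r s) l hy).symm
  have e2 : ∑ s, (∑ r, (D l (fun y => gInv F x y k r) y * fTensor F r s x y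
      + gInv F x y k r * D l (fTensor F r s x) y)) * gInv F x y s h = 0 := by
    simp [e1]
  have e3 : ∑ s, ∑ r, D l (fun y => gInv F x y k r) y * fTensor F r s x y * gInv F x y s h
      = D l (fun y => gInv F x y k h) y := by
    rw [Finset.sum_comm]
    simp only [mul_assoc, ← Finset.mul_sum, gI_mul' hF hx hy, Matrix.one_apply]
    simp
  have e4 : ∑ s, ∑ r, gInv F x y k r * D l (fTensor F r s x) y * gInv F x y s h
      = 2 * cartanUp2 F k h l x y := by
    rw [Finset.sum_comm, cartanUp2, Finset.mul_sum]
    refine Finset.sum_congr rfl fun r _ => ?_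
    rw [Finset.mul_sum]
    refine Finset.sum_congr rfl fun s _ => ?_
    rw [gI_symm hF hx hy s h]
    change _ = 2 * (_ * _ * (1/2 * D l (fTensor F r s x) y))
    ring
  simp only [Finset.sum_mul, add_mul, Finset.sum_add_distrib] at e2
  rw [e3, e4] at e2
  linarith

theorem clm_coord (T : (κ → ℝ) →L[ℝ] ℝ) (y : κ → ℝ) : T y = ∑ a, y a * T (Pi.single a 1) := by
  conv_lhs => rw [pi_eq_sum_univ' y]
  rw [map_sum]
  exact Finset.sum_congr rfl fun a _ => by rw [map_smul, smul_eq_mul]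

theorem euler (hF : IsFinslerMetric U F) {x} (hx : x ∈ U) :
    EqOn (fun y => ∑ a, y a * D a (Lq F x) y) (fun y => 2 * Lq F x y) (slit κ) := by
  intro y hy
  have hd := ((sm_Lf hF hx).diff slit_open hy).hasFDerivAt
  have h1 : HasDerivAt (fun t : ℝ => t • y) y 1 := by
    simpa using (hasDerivAt_id (1:ℝ)).smul_const y
  have h2 : HasDerivAt (fun t : ℝ => Lq F x (t • y)) (fderiv ℝ (Lq F x) y y) 1 := by
    have hd' : HasFDerivAt (Lq F x) (fderiv ℝ (Lq F x) y) ((1:ℝ) • y) := by simpa using hd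
    exact hd'.comp_hasDerivAt (1:ℝ) h1
  have h3 : HasDerivAt (fun t : ℝ => t ^ 2 * Lq F x y) (2 * Lq F x y) 1 := by
    simpa using (hasDerivAt_pow 2 (1:ℝ)).mul_const (Lq F x y)
  have h4 : (fun t : ℝ => Lq F x (t • y)) =ᶠ[nhds 1] (fun t : ℝ => t ^ 2 * Lq F x y) := by
    filter_upwards [lt_mem_nhds (show (0:ℝ) < 1 by norm_num)] with t ht
    simp only [Lq, hF.homog x hx y t ht]; ring
  have h5 := (h2.congr_of_eventuallyEq h4.symm).unique h3
  simp only
  rw [← h5]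
  exact (clm_coord _ y).symm

theorem D_L (hF : IsFinslerMetric U F) {x} (hx : x ∈ U) (b : κ) :
    EqOn (D b (Lq F x)) (fun y => 2 * lowerY F b x y) (slit κ) := by
  intro y hy
  have hL := sm_Lf hF hx
  have h1 := D_congr slit_open (euler hF hx) b hy
  rw [D_sum slit_open (fun a => (sm_coord a).mul (hL.D slit_open a)) b hy,
    D_mulc slit_open hL 2 b hy] at h1
  have h2 : ∀ a, D b (fun y => y a * D a (Lq F x) y) y
      = (Pi.single b (1:ℝ) : κ → ℝ) a * D a (Lq F x) y + y a * D b (D a (Lq F x)) y := by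
    intro a
    rw [D_mul slit_open (sm_coord a) (hL.D slit_open a) b hy, D_coord]
  simp only [h2, Finset.sum_add_distrib] at h1
  have h3 : ∑ a, (Pi.single b (1:ℝ) : κ → ℝ) a * D a (Lq F x) y = D b (Lq F x) y := by
    simp [Pi.single_apply]
  have h4 : 2 * lowerY F b x y = ∑ a, y a * D b (D a (Lq F x)) y := by
    rw [lowerY, Finset.mul_sum]
    refine Finset.sum_congr rfl fun a _ => ?_
    rw [fT_eq]; ring
  simp only
  rw [h4]; linarith

theorem sm_spray (hF : IsFinslerMetric U F) {x} (hx : x ∈ U) (i : κ) :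
    Sm (slit κ) (sprayCoef F i x) := by
  refine contDiffOn_const.mul (sm_sum fun l => (sm_gI hF hx i l).mul (ContDiffOn.sub ?_ ?_))
  · refine sm_sum fun k => (sm_coord k).mul ?_
    exact fib (sm_pdx hF.isOpen slit_open (sm_pdy hF.isOpen slit_open (sm_L hF) l) k) hx
  · exact fib (sm_pdx hF.isOpen slit_open (sm_L hF) l) hx

end fin

section prod
variable {κ₁ κ₂ : Type*} [Fintype κ₁] [DecidableEq κ₁] [Fintype κ₂] [DecidableEq κ₂]

/-- Projection to the first block. -/
def P1 (κ₁ κ₂ : Type*) [Fintype κ₁] [Fintype κ₂] : (κ₁ ⊕ κ₂ → ℝ) →L[ℝ] (κ₁ → ℝ) :=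
  ContinuousLinearMap.pi fun i => ContinuousLinearMap.proj (Sum.inl i)

/-- Projection to the second block. -/
def P2 (κ₁ κ₂ : Type*) [Fintype κ₁] [Fintype κ₂] : (κ₁ ⊕ κ₂ → ℝ) →L[ℝ] (κ₂ → ℝ) :=
  ContinuousLinearMap.pi fun i => ContinuousLinearMap.proj (Sum.inr i)

theorem P1_l (i : κ₁) : P1 κ₁ κ₂ (Pi.single (Sum.inl i) 1) = Pi.single i 1 := by
  funext j; simp [P1, Pi.single_apply]
theorem P1_r (i : κ₂) : P1 κ₁ κ₂ (Pi.single (Sum.inr i) 1) = 0 := by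
  funext j; simp [P1, Pi.single_apply]
theorem P2_r (i : κ₂) : P2 κ₁ κ₂ (Pi.single (Sum.inr i) 1) = Pi.single i 1 := by
  funext j; simp [P2, Pi.single_apply]
theorem P2_l (i : κ₁) : P2 κ₁ κ₂ (Pi.single (Sum.inl i) 1) = 0 := by
  funext j; simp [P2, Pi.single_apply]

/-- The product of two open blocks. -/
def SS (S : Set (κ₁ → ℝ)) (T : Set (κ₂ → ℝ)) : Set (κ₁ ⊕ κ₂ → ℝ) :=
  {Y | Y ∘ Sum.inl ∈ S ∧ Y ∘ Sum.inr ∈ T}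

variable {S : Set (κ₁ → ℝ)} {T : Set (κ₂ → ℝ)}

theorem SS_open (hS : IsOpen S) (hT : IsOpen T) : IsOpen (SS S T) :=
  (hS.preimage (P1 κ₁ κ₂).continuous).inter (hT.preimage (P2 κ₁ κ₂).continuous)

theorem sm_p1 {A : (κ₁ → ℝ) → ℝ} (h : Sm S A) : Sm (SS S T) (fun Y => A (Y ∘ Sum.inl)) :=
  h.comp (P1 κ₁ κ₂).contDiff.contDiffOn fun _ hY => hY.1
theorem sm_p2 {A : (κ₂ → ℝ) → ℝ} (h : Sm T A) : Sm (SS S T) (fun Y => A (Y ∘ Sum.inr)) :=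
  h.comp (P2 κ₁ κ₂).contDiff.contDiffOn fun _ hY => hY.2

theorem fd1 {A : (κ₁ → ℝ) → ℝ} {Y : κ₁ ⊕ κ₂ → ℝ} (h : DifferentiableAt ℝ A (Y ∘ Sum.inl)) :
    fderiv ℝ (fun Y : κ₁ ⊕ κ₂ → ℝ => A (Y ∘ Sum.inl)) Y
      = (fderiv ℝ A (Y ∘ Sum.inl)).comp (P1 κ₁ κ₂) := by
  have h1 : HasFDerivAt A (fderiv ℝ A (Y ∘ Sum.inl)) (P1 κ₁ κ₂ Y) := h.hasFDerivAt
  exact (h1.comp Y (P1 κ₁ κ₂).hasFDerivAt).fderiv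
theorem fd2 {A : (κ₂ → ℝ) → ℝ} {Y : κ₁ ⊕ κ₂ → ℝ} (h : DifferentiableAt ℝ A (Y ∘ Sum.inr)) :
    fderiv ℝ (fun Y : κ₁ ⊕ κ₂ → ℝ => A (Y ∘ Sum.inr)) Y
      = (fderiv ℝ A (Y ∘ Sum.inr)).comp (P2 κ₁ κ₂) := by
  have h1 : HasFDerivAt A (fderiv ℝ A (Y ∘ Sum.inr)) (P2 κ₁ κ₂ Y) := h.hasFDerivAt
  exact (h1.comp Y (P2 κ₁ κ₂).hasFDerivAt).fderiv

theorem D1l {A : (κ₁ → ℝ) → ℝ} {Y : κ₁ ⊕ κ₂ → ℝ} (h : DifferentiableAt ℝ A (Y ∘ Sum.inl)) (i : κ₁) :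
    D (Sum.inl i) (fun Y : κ₁ ⊕ κ₂ → ℝ => A (Y ∘ Sum.inl)) Y = D i A (Y ∘ Sum.inl) := by
  simp [D, fd1 h, P1_l]
theorem D1r {A : (κ₁ → ℝ) → ℝ} {Y : κ₁ ⊕ κ₂ → ℝ} (h : DifferentiableAt ℝ A (Y ∘ Sum.inl)) (i : κ₂) :
    D (Sum.inr i) (fun Y : κ₁ ⊕ κ₂ → ℝ => A (Y ∘ Sum.inl)) Y = 0 := by
  simp [D, fd1 h, P1_r]
theorem D2r {A : (κ₂ → ℝ) → ℝ} {Y : κ₁ ⊕ κ₂ → ℝ} (h : DifferentiableAt ℝ A (Y ∘ Sum.inr)) (i : κ₂) :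
    D (Sum.inr i) (fun Y : κ₁ ⊕ κ₂ → ℝ => A (Y ∘ Sum.inr)) Y = D i A (Y ∘ Sum.inr) := by
  simp [D, fd2 h, P2_r]
theorem D2l {A : (κ₂ → ℝ) → ℝ} {Y : κ₁ ⊕ κ₂ → ℝ} (h : DifferentiableAt ℝ A (Y ∘ Sum.inr)) (i : κ₁) :
    D (Sum.inl i) (fun Y : κ₁ ⊕ κ₂ → ℝ => A (Y ∘ Sum.inr)) Y = 0 := by
  simp [D, fd2 h, P2_l]

/-- Sum of two products of functions of the separate blocks. -/
def tt (A : (κ₁ → ℝ) → ℝ) (B : (κ₂ → ℝ) → ℝ) (A' : (κ₁ → ℝ) → ℝ) (B' : (κ₂ → ℝ) → ℝ)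
    (Y : κ₁ ⊕ κ₂ → ℝ) : ℝ :=
  A (Y ∘ Sum.inl) * B (Y ∘ Sum.inr) + A' (Y ∘ Sum.inl) * B' (Y ∘ Sum.inr)

theorem step_l (hS : IsOpen S) (hT : IsOpen T) {G : (κ₁ ⊕ κ₂ → ℝ) → ℝ} {A A' : (κ₁ → ℝ) → ℝ}
    {B B' : (κ₂ → ℝ) → ℝ} (hA : Sm S A) (hA' : Sm S A') (hB : Sm T B) (hB' : Sm T B')
    (h : EqOn G (tt A B A' B') (SS S T)) (i : κ₁) :
    EqOn (D (Sum.inl i) G) (tt (D i A) B (D i A') B') (SS S T) := by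
  have hO := SS_open hS hT
  intro Y hY
  rw [D_congr hO h _ hY]
  unfold tt
  rw [D_add hO ((sm_p1 hA).mul (sm_p2 hB)) ((sm_p1 hA').mul (sm_p2 hB')) _ hY]
  simp only
  rw [D_mul hO (sm_p1 hA) (sm_p2 hB) _ hY, D_mul hO (sm_p1 hA') (sm_p2 hB') _ hY]
  simp only
  rw [D1l (hA.diff hS hY.1), D1l (hA'.diff hS hY.1), D2l (hB.diff hT hY.2), D2l (hB'.diff hT hY.2)]
  ring

theorem step_r (hS : IsOpen S) (hT : IsOpen T) {G : (κ₁ ⊕ κ₂ → ℝ) → ℝ} {A A' : (κ₁ → ℝ) → ℝ}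
    {B B' : (κ₂ → ℝ) → ℝ} (hA : Sm S A) (hA' : Sm S A') (hB : Sm T B) (hB' : Sm T B')
    (h : EqOn G (tt A B A' B') (SS S T)) (i : κ₂) :
    EqOn (D (Sum.inr i) G) (tt A (D i B) A' (D i B')) (SS S T) := by
  have hO := SS_open hS hT
  intro Y hY
  rw [D_congr hO h _ hY]
  unfold tt
  rw [D_add hO ((sm_p1 hA).mul (sm_p2 hB)) ((sm_p1 hA').mul (sm_p2 hB')) _ hY]
  simp only
  rw [D_mul hO (sm_p1 hA) (sm_p2 hB) _ hY, D_mul hO (sm_p1 hA') (sm_p2 hB') _ hY]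
  simp only
  rw [D1r (hA.diff hS hY.1), D1r (hA'.diff hS hY.1), D2r (hB.diff hT hY.2), D2r (hB'.diff hT hY.2)]
  ring

end prod

section tw
variable {n₁ n₂ : ℕ} {U₁ : Set (Fin n₁ → ℝ)} {U₂ : Set (Fin n₂ → ℝ)}
    {F₁ : (Fin n₁ → ℝ) → (Fin n₁ → ℝ) → ℝ}
    {F₂ : (Fin n₂ → ℝ) → (Fin n₂ → ℝ) → ℝ}
    {f : (Fin n₁ → ℝ) → (Fin n₂ → ℝ) → ℝ}

/-- The slit domain of the product. -/
abbrev SL (n₁ n₂ : ℕ) : Set (Fin n₁ ⊕ Fin n₂ → ℝ) := SS (slit (Fin n₁)) (slit (Fin n₂))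

theorem Lq_tw (X : Fin n₁ ⊕ Fin n₂ → ℝ) :
    Lq (twisted F₁ F₂ f) X = tt (Lq F₁ (X ∘ Sum.inl)) (fun _ => 1)
      (fun _ => (f (X ∘ Sum.inl) (X ∘ Sum.inr)) ^ 2) (Lq F₂ (X ∘ Sum.inr)) := by
  funext Y
  simp only [Lq, twisted, tt]
  rw [Real.sq_sqrt (by positivity)]; ring

theorem one_sm {E : Type*} [NormedAddCommGroup E] [NormedSpace ℝ E] {S : Set E} (c : ℝ) :
    Sm S (fun _ => c) := contDiffOn_const

theorem DL_l (hF₁ : IsFinslerMetric U₁ F₁) (hF₂ : IsFinslerMetric U₂ F₂)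
    {X : Fin n₁ ⊕ Fin n₂ → ℝ} (hX : X ∈ SS U₁ U₂) (l : Fin n₁) :
    EqOn (D (Sum.inl l) (Lq (twisted F₁ F₂ f) X))
      (tt (D l (Lq F₁ (X ∘ Sum.inl))) (fun _ => 1) (fun _ => 0) (fun _ => 0)) (SL n₁ n₂) := by
  intro Y hY
  rw [step_l slit_open slit_open (sm_Lf hF₁ hX.1) (one_sm _) (one_sm _) (sm_Lf hF₂ hX.2)
    (fun Z _ => congrFun (Lq_tw X) Z) l hY, D_const]
  simp [tt]

theorem DL_r (hF₁ : IsFinslerMetric U₁ F₁) (hF₂ : IsFinslerMetric U₂ F₂)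
    {X : Fin n₁ ⊕ Fin n₂ → ℝ} (hX : X ∈ SS U₁ U₂) (l : Fin n₂) :
    EqOn (D (Sum.inr l) (Lq (twisted F₁ F₂ f) X))
      (tt (fun _ => 0) (fun _ => 0) (fun _ => (f (X ∘ Sum.inl) (X ∘ Sum.inr)) ^ 2)
        (D l (Lq F₂ (X ∘ Sum.inr)))) (SL n₁ n₂) := by
  intro Y hY
  rw [step_r slit_open slit_open (sm_Lf hF₁ hX.1) (one_sm _) (one_sm _) (sm_Lf hF₂ hX.2)
    (fun Z _ => congrFun (Lq_tw X) Z) l hY, D_const]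
  simp [tt]

theorem gMat_tw (hF₁ : IsFinslerMetric U₁ F₁) (hF₂ : IsFinslerMetric U₂ F₂)
    {X : Fin n₁ ⊕ Fin n₂ → ℝ} (hX : X ∈ SS U₁ U₂) {Y} (hY : Y ∈ SL n₁ n₂) :
    gMat (twisted F₁ F₂ f) X Y = Matrix.fromBlocks (gMat F₁ (X ∘ Sum.inl) (Y ∘ Sum.inl)) 0 0
      ((f (X ∘ Sum.inl) (X ∘ Sum.inr)) ^ 2 • gMat F₂ (X ∘ Sum.inr) (Y ∘ Sum.inr)) := by
  have h1 := fun l => (sm_Lf hF₁ hX.1).D slit_open l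
  have h2 := fun l => (sm_Lf hF₂ hX.2).D slit_open l
  ext a b
  rcases a with a | a <;> rcases b with b | b <;>
    simp only [gMat, Matrix.of_apply, Matrix.fromBlocks_apply₁₁, Matrix.fromBlocks_apply₁₂,
      Matrix.fromBlocks_apply₂₁, Matrix.fromBlocks_apply₂₂, Matrix.smul_apply, Matrix.zero_apply,
      fT_eq, smul_eq_mul]
  · rw [step_l slit_open slit_open (h1 b) (one_sm _) (one_sm _) (one_sm _) (DL_l hF₁ hF₂ hX b) a hY]
    simp [tt]
  · rw [step_l slit_open slit_open (one_sm _) (one_sm _) (one_sm _) (h2 b) (DL_r hF₁ hF₂ hX b) a hY]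
    simp [tt, D_const]
  · rw [step_r slit_open slit_open (h1 b) (one_sm _) (one_sm _) (one_sm _) (DL_l hF₁ hF₂ hX b) a hY]
    simp [tt, D_const]
  · rw [step_r slit_open slit_open (one_sm _) (one_sm _) (one_sm _) (h2 b) (DL_r hF₁ hF₂ hX b) a hY]
    simp [tt]; ring

theorem gInv_tw (hF₁ : IsFinslerMetric U₁ F₁) (hF₂ : IsFinslerMetric U₂ F₂)
    {X : Fin n₁ ⊕ Fin n₂ → ℝ} (hX : X ∈ SS U₁ U₂)
    (hf0 : f (X ∘ Sum.inl) (X ∘ Sum.inr) ≠ 0) {Y} (hY : Y ∈ SL n₁ n₂) :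
    gInv (twisted F₁ F₂ f) X Y = Matrix.fromBlocks (gInv F₁ (X ∘ Sum.inl) (Y ∘ Sum.inl)) 0 0
      (((f (X ∘ Sum.inl) (X ∘ Sum.inr)) ^ 2)⁻¹ • gInv F₂ (X ∘ Sum.inr) (Y ∘ Sum.inr)) := by
  rw [gInv, gMat_tw hF₁ hF₂ hX hY]
  apply Matrix.inv_eq_right_inv
  rw [Matrix.fromBlocks_multiply]
  simp only [gInv, Matrix.mul_nonsing_inv _ (g_det hF₁ hX.1 hY.1).isUnit,
    Matrix.mul_zero, Matrix.zero_mul, add_zero, zero_add, Matrix.smul_mul, Matrix.mul_smul,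
    Matrix.mul_nonsing_inv _ (g_det hF₂ hX.2 hY.2).isUnit, smul_zero]
  rw [smul_smul, inv_mul_cancel₀ (pow_ne_zero 2 hf0), one_smul, Matrix.fromBlocks_one]

theorem f_sm (hf : Sm (U₁ ×ˢ U₂) (fun p : (Fin n₁ → ℝ) × (Fin n₂ → ℝ) => f p.1 p.2)) :
    Sm (SS U₁ U₂) (fun X => f (X ∘ Sum.inl) (X ∘ Sum.inr)) :=
  hf.comp ((P1 (Fin n₁) (Fin n₂)).prod (P2 (Fin n₁) (Fin n₂))).contDiff.contDiffOn
    (fun _ hX => hX)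

theorem f_fd (hU₁ : IsOpen U₁) (hU₂ : IsOpen U₂)
    (hf : Sm (U₁ ×ˢ U₂) (fun p : (Fin n₁ → ℝ) × (Fin n₂ → ℝ) => f p.1 p.2))
    {X : Fin n₁ ⊕ Fin n₂ → ℝ} (hX : X ∈ SS U₁ U₂) :
    (∀ l, D (Sum.inl l) (fun X : Fin n₁ ⊕ Fin n₂ → ℝ => f (X ∘ Sum.inl) (X ∘ Sum.inr)) X
      = pdx l f (X ∘ Sum.inl) (X ∘ Sum.inr)) ∧
    (∀ l, D (Sum.inr l) (fun X : Fin n₁ ⊕ Fin n₂ → ℝ => f (X ∘ Sum.inl) (X ∘ Sum.inr)) X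
      = pdy l f (X ∘ Sum.inl) (X ∘ Sum.inr)) := by
  have hd := (hf.diff (hU₁.prod hU₂) (y := (X ∘ Sum.inl, X ∘ Sum.inr)) hX).hasFDerivAt
  have h1 := HasFDerivAt.comp X (f := (P1 (Fin n₁) (Fin n₂)).prod (P2 (Fin n₁) (Fin n₂))) hd
    ((P1 (Fin n₁) (Fin n₂)).prod (P2 (Fin n₁) (Fin n₂))).hasFDerivAt
  have h1' : fderiv ℝ (fun X : Fin n₁ ⊕ Fin n₂ → ℝ => f (X ∘ Sum.inl) (X ∘ Sum.inr)) X = _ :=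
    h1.fderiv
  have h2 := HasFDerivAt.comp (X ∘ Sum.inl) (f := fun x' => (x', X ∘ Sum.inr)) hd
    (hasFDerivAt_prodMk_left (X ∘ Sum.inl) (X ∘ Sum.inr))
  have h2' : fderiv ℝ (fun x' => f x' (X ∘ Sum.inr)) (X ∘ Sum.inl) = _ := h2.fderiv
  have h3 := HasFDerivAt.comp (X ∘ Sum.inr) (f := fun x' => (X ∘ Sum.inl, x')) hd
    (hasFDerivAt_prodMk_right (X ∘ Sum.inl) (X ∘ Sum.inr))
  have h3' : fderiv ℝ (fun x' => f (X ∘ Sum.inl) x') (X ∘ Sum.inr) = _ := h3.fderiv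
  constructor
  · intro l
    simp [D, pdx, h1', h2', P1_l, P2_l]
  · intro l
    simp [D, pdy, h1', h3', P1_r, P2_r]

theorem base_D (hU₁ : IsOpen U₁) (hU₂ : IsOpen U₂)
    (hf : Sm (U₁ ×ˢ U₂) (fun p : (Fin n₁ → ℝ) × (Fin n₂ → ℝ) => f p.1 p.2))
    {X : Fin n₁ ⊕ Fin n₂ → ℝ} (hX : X ∈ SS U₁ U₂) {A : (Fin n₁ → ℝ) → ℝ} {B : (Fin n₂ → ℝ) → ℝ}
    (hA : Sm U₁ A) (hB : Sm U₂ B) {H : (Fin n₁ ⊕ Fin n₂ → ℝ) → ℝ}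
    (hH : EqOn H (fun X => A (X ∘ Sum.inl)
      + (f (X ∘ Sum.inl) (X ∘ Sum.inr)) ^ 2 * B (X ∘ Sum.inr)) (SS U₁ U₂)) :
    (∀ l, D (Sum.inl l) H X = D l A (X ∘ Sum.inl)
      + 2 * f (X ∘ Sum.inl) (X ∘ Sum.inr) * pdx l f (X ∘ Sum.inl) (X ∘ Sum.inr) * B (X ∘ Sum.inr)) ∧
    (∀ l, D (Sum.inr l) H X =
      2 * f (X ∘ Sum.inl) (X ∘ Sum.inr) * pdy l f (X ∘ Sum.inl) (X ∘ Sum.inr) * B (X ∘ Sum.inr)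
      + (f (X ∘ Sum.inl) (X ∘ Sum.inr)) ^ 2 * D l B (X ∘ Sum.inr)) := by
  have hO := SS_open hU₁ hU₂
  have hff := f_sm hf
  obtain ⟨e1, e2⟩ := f_fd hU₁ hU₂ hf hX
  have hsq : EqOn H (fun X => A (X ∘ Sum.inl)
      + (f (X ∘ Sum.inl) (X ∘ Sum.inr) * f (X ∘ Sum.inl) (X ∘ Sum.inr)) * B (X ∘ Sum.inr))
      (SS U₁ U₂) := by
    intro Z hZ; rw [hH hZ]; ring
  have gen : ∀ c, D c H X = D c (fun X : Fin n₁ ⊕ Fin n₂ → ℝ => A (X ∘ Sum.inl)) X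
      + (2 * f (X ∘ Sum.inl) (X ∘ Sum.inr)
        * D c (fun X : Fin n₁ ⊕ Fin n₂ → ℝ => f (X ∘ Sum.inl) (X ∘ Sum.inr)) X * B (X ∘ Sum.inr)
      + (f (X ∘ Sum.inl) (X ∘ Sum.inr)) ^ 2
        * D c (fun X : Fin n₁ ⊕ Fin n₂ → ℝ => B (X ∘ Sum.inr)) X) := by
    intro c
    rw [D_congr hO hsq c hX, D_add hO (sm_p1 hA) ((hff.mul hff).mul (sm_p2 hB)) c hX]
    simp only
    rw [D_mul hO (hff.mul hff) (sm_p2 hB) c hX]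
    simp only
    rw [D_mul hO hff hff c hX]
    ring
  constructor
  · intro l
    rw [gen, e1, D1l (hA.diff hU₁ hX.1), D2l (hB.diff hU₂ hX.2)]; ring
  · intro l
    rw [gen, e2, D1r (hA.diff hU₁ hX.1), D2r (hB.diff hU₂ hX.2)]; ring

theorem spray_eq {κ : Type*} [Fintype κ] [DecidableEq κ] (F : (κ → ℝ) → (κ → ℝ) → ℝ) (i : κ)
    (x y : κ → ℝ) : sprayCoef F i x y = (1/4) * ∑ l, gInv F x y i l *
    ((∑ k, y k * D k (fun x' => D l (Lq F x') y) x) - D l (fun x' => Lq F x' y) x) := rfl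

theorem spray_tw (hF₁ : IsFinslerMetric U₁ F₁) (hF₂ : IsFinslerMetric U₂ F₂)
    (hf : Sm (U₁ ×ˢ U₂) (fun p : (Fin n₁ → ℝ) × (Fin n₂ → ℝ) => f p.1 p.2))
    {X : Fin n₁ ⊕ Fin n₂ → ℝ} (hX : X ∈ SS U₁ U₂)
    {x : Fin n₁ → ℝ} {u : Fin n₂ → ℝ} (hx : X ∘ Sum.inl = x) (hu : X ∘ Sum.inr = u)
    (hf0 : f x u ≠ 0) :
    (∀ k, EqOn (sprayCoef (twisted F₁ F₂ f) (Sum.inl k) X)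
      (tt (sprayCoef F₁ k x) (fun _ => 1)
        (fun y => ∑ h, gInv F₁ x y k h * (-(1/2) * f x u * pdx h f x u)) (Lq F₂ u)) (SL n₁ n₂)) ∧
    (∀ γ, EqOn (sprayCoef (twisted F₁ F₂ f) (Sum.inr γ) X)
      (tt (fun _ => 1)
        (fun v => sprayCoef F₂ γ u v + ((∑ a, v a * ((f x u)⁻¹ * pdy a f x u)) * v γ
          + (∑ ν, gInv F₂ u v γ ν * (-(1/2) * (f x u)⁻¹ * pdy ν f x u)) * Lq F₂ u v))
        (fun y => ∑ h, y h * ((f x u)⁻¹ * pdx h f x u)) (fun v => v γ)) (SL n₁ n₂)) := by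
  have hU₁ := hF₁.isOpen
  have hU₂ := hF₂.isOpen
  have hL : ∀ Y ∈ SL n₁ n₂, _ := fun Y (hY : Y ∈ SL n₁ n₂) =>
    base_D hU₁ hU₂ hf hX (bas (sm_L hF₁) hY.1) (bas (sm_L hF₂) hY.2)
      (H := fun X' => Lq (twisted F₁ F₂ f) X' Y)
      (by intro Z _; simp only [Lq_tw, tt, mul_one])
  have hl : ∀ Y ∈ SL n₁ n₂, ∀ l : Fin n₁, _ := fun Y (hY : Y ∈ SL n₁ n₂) l =>
    base_D hU₁ hU₂ hf hX (A := fun x' => D l (Lq F₁ x') (Y ∘ Sum.inl)) (B := fun _ => 0)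
      (bas (sm_pdy hU₁ slit_open (sm_L hF₁) l) hY.1) (one_sm 0)
      (H := fun X' => D (Sum.inl l) (Lq (twisted F₁ F₂ f) X') Y)
      (by intro Z hZ; simp only [DL_l hF₁ hF₂ hZ l hY, tt, mul_one, mul_zero])
  have hr : ∀ Y ∈ SL n₁ n₂, ∀ l : Fin n₂, _ := fun Y (hY : Y ∈ SL n₁ n₂) l =>
    base_D hU₁ hU₂ hf hX (B := fun x' => D l (Lq F₂ x') (Y ∘ Sum.inr)) (A := fun _ => 0)
      (one_sm 0) (bas (sm_pdy hU₂ slit_open (sm_L hF₂) l) hY.2)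
      (H := fun X' => D (Sum.inr l) (Lq (twisted F₁ F₂ f) X') Y)
      (by intro Z hZ; simp only [DL_r hF₁ hF₂ hZ l hY, tt, mul_zero])
  simp only [hx, hu, D_const, mul_zero, zero_add, add_zero] at hL hl hr
  have hx' : x ∈ U₁ := hx ▸ hX.1
  have hu' : u ∈ U₂ := hu ▸ hX.2
  constructor
  · intro k Y hY
    have hg := gInv_tw (f := f) hF₁ hF₂ hX (by rw [hx, hu]; exact hf0) hY
    rw [hx, hu] at hg
    simp only [tt]
    rw [spray_eq, spray_eq, hg, Fintype.sum_sum_type]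
    simp only [Matrix.fromBlocks_apply₁₁, Matrix.fromBlocks_apply₁₂, Matrix.zero_apply, zero_mul,
      Finset.sum_const_zero, add_zero, Fintype.sum_sum_type, (hl Y hY _).1, (hl Y hY _).2,
      (hL Y hY).1, mul_zero, mul_one]
    rw [Finset.mul_sum, Finset.mul_sum, Finset.sum_mul, ← Finset.sum_add_distrib]
    refine Finset.sum_congr rfl fun l _ => ?_
    simp only [Function.comp]
    ring
  · intro γ Y hY
    have hg := gInv_tw (f := f) hF₁ hF₂ hX (by rw [hx, hu]; exact hf0) hY
    rw [hx, hu] at hg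
    have hv : ∑ ν, gInv F₂ u (Y ∘ Sum.inr) γ ν * D ν (Lq F₂ u) (Y ∘ Sum.inr) = 2 * Y (Sum.inr γ) := by
      have : ∀ ν, D ν (Lq F₂ u) (Y ∘ Sum.inr) = 2 * lowerY F₂ ν u (Y ∘ Sum.inr) :=
        fun ν => D_L hF₂ hu' ν hY.2
      simp only [this, lowerY, Finset.mul_sum]
      rw [Finset.sum_comm]
      have e : ∀ b, ∑ ν, gInv F₂ u (Y ∘ Sum.inr) γ ν * (2 * (fTensor F₂ ν b u (Y ∘ Sum.inr) * (Y ∘ Sum.inr) b))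
          = 2 * (Y ∘ Sum.inr) b * (1 : Matrix (Fin n₂) (Fin n₂) ℝ) γ b := by
        intro b
        rw [← gI_mul hF₂ hu' hY.2 γ b, Finset.mul_sum]
        exact Finset.sum_congr rfl fun ν _ => by ring
      simp only [e, Matrix.one_apply]
      simp
    simp only [tt]
    rw [spray_eq, spray_eq, hg, Fintype.sum_sum_type]
    simp only [Matrix.fromBlocks_apply₂₁, Matrix.fromBlocks_apply₂₂, Matrix.zero_apply, zero_mul,
      Finset.sum_const_zero, zero_add, Fintype.sum_sum_type, (hr Y hY _).1, (hr Y hY _).2,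
      (hL Y hY).2, one_mul, Matrix.smul_apply, smul_eq_mul]
    have s1 : ∑ a, (Y ∘ Sum.inr) a * ((f x u)⁻¹ * pdy a f x u)
        = (f x u)⁻¹ * ∑ a, Y (Sum.inr a) * pdy a f x u := by
      rw [Finset.mul_sum]; exact Finset.sum_congr rfl fun a _ => by simp only [Function.comp]; ring
    have s2 : ∑ a, (Y ∘ Sum.inl) a * ((f x u)⁻¹ * pdx a f x u)
        = (f x u)⁻¹ * ∑ a, Y (Sum.inl a) * pdx a f x u := by
      rw [Finset.mul_sum]; exact Finset.sum_congr rfl fun a _ => by simp only [Function.comp]; ring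
    have s3 : ∀ d : ℝ, ∑ a, Y (Sum.inl a) * (2 * f x u * pdx a f x u * d)
        = 2 * f x u * d * ∑ a, Y (Sum.inl a) * pdx a f x u := by
      intro d
      rw [Finset.mul_sum]; exact Finset.sum_congr rfl fun a _ => by ring
    have s4 : ∀ (d : ℝ) (q : Fin n₂ → ℝ),
        ∑ a, Y (Sum.inr a) * (2 * f x u * pdy a f x u * d + f x u ^ 2 * q a)
        = 2 * f x u * d * (∑ a, Y (Sum.inr a) * pdy a f x u)
          + f x u ^ 2 * ∑ a, (Y ∘ Sum.inr) a * q a := by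
      intro d q
      rw [Finset.mul_sum, Finset.mul_sum, ← Finset.sum_add_distrib]
      exact Finset.sum_congr rfl fun a _ => by simp only [Function.comp]; ring
    have hv' : (Y ∘ Sum.inr) γ = (1/2) *
      ∑ ν, gInv F₂ u (Y ∘ Sum.inr) γ ν * D ν (Lq F₂ u) (Y ∘ Sum.inr) := by
      rw [hv]; simp only [Function.comp]; ring
    simp only [s1, s2, s3, s4, hv']
    generalize (∑ a, Y (Sum.inl a) * pdx a f x u) = a1
    generalize (∑ a, Y (Sum.inr a) * pdy a f x u) = a2
    simp only [Finset.mul_sum, Finset.sum_mul]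
    rw [← Finset.sum_add_distrib, ← Finset.sum_add_distrib, ← Finset.sum_add_distrib]
    refine Finset.sum_congr rfl fun l _ => ?_
    simp only [← Finset.mul_sum, ← Finset.sum_mul]
    field_simp
    ring

end tw

section final
variable {κ : Type*} [Fintype κ] [DecidableEq κ]

theorem D2_lin {S : Set (κ → ℝ)} (hS : IsOpen S) {τ : Type*} [Fintype τ] {A : τ → (κ → ℝ) → ℝ}
    (h : ∀ t, Sm S (A t)) (c : τ → ℝ) (i j : κ) :
    EqOn (D i (D j (fun y => ∑ t, A t y * c t))) (fun y => ∑ t, D i (D j (A t)) y * c t) S :=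
  (D_congr hS (D_lin hS h c j) i).trans (D_lin hS (fun t => (h t).D hS j) c i)

theorem D3_lin {S : Set (κ → ℝ)} (hS : IsOpen S) {τ : Type*} [Fintype τ] {A : τ → (κ → ℝ) → ℝ}
    (h : ∀ t, Sm S (A t)) (c : τ → ℝ) (i j k : κ) :
    EqOn (D i (D j (D k (fun y => ∑ t, A t y * c t))))
      (fun y => ∑ t, D i (D j (D k (A t))) y * c t) S :=
  (D_congr hS (D2_lin hS h c j k) i).trans (D_lin hS (fun t => ((h t).D hS k).D hS j) c i)

theorem D3_add {S : Set (κ → ℝ)} (hS : IsOpen S) {A B : (κ → ℝ) → ℝ} (hA : Sm S A) (hB : Sm S B)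
    (i j k : κ) : EqOn (D i (D j (D k (fun y => A y + B y))))
      (fun y => D i (D j (D k A)) y + D i (D j (D k B)) y) S := by
  have e1 := D_add hS hA hB k
  have e2 := (D_congr hS e1 j).trans (D_add hS (hA.D hS k) (hB.D hS k) j)
  exact (D_congr hS e2 i).trans (D_add hS ((hA.D hS k).D hS j) ((hB.D hS k).D hS j) i)

variable {U : Set (κ → ℝ)} {F : (κ → ℝ) → (κ → ℝ) → ℝ}

theorem D2_gI (hF : IsFinslerMetric U F) {x} (hx : x ∈ U) (k h i j : κ) :
    EqOn (D i (D j (fun y => gInv F x y k h))) (fun y => -2 * D i (cartanUp2 F k h j x) y) (slit κ) :=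
  (D_congr slit_open (D_gI hF hx k h j) i).trans (D_mulc slit_open (sm_C2 hF hx k h j) _ i)

theorem D2_gI' (hF : IsFinslerMetric U F) {x} (hx : x ∈ U) (k h i j : κ) :
    EqOn (D i (D j (fun y => gInv F x y k h))) (fun y => -2 * D j (cartanUp2 F k h i x) y) (slit κ) :=
  (D_comm slit_open (sm_gI hF hx k h) i j).trans (D2_gI hF hx k h j i)

theorem D3_gI (hF : IsFinslerMetric U F) {x} (hx : x ∈ U) (k h i j l : κ) :
    EqOn (D i (D j (D l (fun y => gInv F x y k h))))
      (fun y => -2 * D i (D j (cartanUp2 F k h l x)) y) (slit κ) :=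
  (D_congr slit_open (D2_gI hF hx k h j l) i).trans
    (D_mulc slit_open ((sm_C2 hF hx k h l).D slit_open j) _ i)

theorem D2_L (a b : κ) (x y : κ → ℝ) : D a (D b (Lq F x)) y = 2 * fTensor F a b x y := by
  rw [fT_eq]; ring

theorem D3_L (hF : IsFinslerMetric U F) {x} (hx : x ∈ U) (a b c : κ) :
    EqOn (D a (D b (D c (Lq F x)))) (fun y => 4 * cartan F a b c x y) (slit κ) := by
  intro y hy
  have hL := sm_Lf hF hx
  rw [D_congr slit_open (D_comm slit_open hL b c) a hy, D_comm slit_open (hL.D slit_open b) a c hy]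
  have : cartan F a b c x y = (1/2) * D c (fTensor F a b x) y := rfl
  simp only
  rw [this, fT_eq, D_mulc slit_open ((hL.D slit_open b).D slit_open a) _ c hy]
  ring

theorem sumc {τ : Type*} [Fintype τ] (q p : τ → ℝ) (s : ℝ) :
    ∑ h, -2 * q h * (-(1/2) * s * p h) = s * ∑ h, q h * p h := by
  rw [Finset.mul_sum]; exact Finset.sum_congr rfl fun _ _ => by ring

theorem sumc' {τ : Type*} [Fintype τ] (q p : τ → ℝ) (s : ℝ) :
    ∑ h, q h * (-(1/2) * s * p h) = -(1/2) * s * ∑ h, q h * p h := by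
  rw [Finset.mul_sum]; exact Finset.sum_congr rfl fun _ _ => by ring

theorem D3_quad (c : κ → ℝ) (g i j k : κ) {y : κ → ℝ} (hy : y ∈ slit κ) :
    D i (D j (D k (fun v => (∑ a, v a * c a) * v g))) y = 0 := by
  have hl : Sm (slit κ) (fun v : κ → ℝ => ∑ a, v a * c a) := sm_lin (fun a => sm_coord a) c
  rw [D3_mul slit_open hl (sm_coord g) i j k hy]
  have e2 : ∀ i j, D i (D j (fun v : κ → ℝ => ∑ a, v a * c a)) y = 0 := by
    intro i j
    rw [D2_lin slit_open (fun a => sm_coord a) c i j hy]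
    simp [D_coord, D_const]
  have e3 : D i (D j (D k (fun v : κ → ℝ => ∑ a, v a * c a))) y = 0 := by
    rw [D3_lin slit_open (fun a => sm_coord a) c i j k hy]
    simp [D_coord, D_const]
  simp only [e2, e3, D_coord, D_const]
  ring

end final

end TW

theorem stmt_12 {n₁ n₂ : ℕ} {U₁ : Set (Fin n₁ → ℝ)} {U₂ : Set (Fin n₂ → ℝ)}
    {F₁ : (Fin n₁ → ℝ) → (Fin n₁ → ℝ) → ℝ}
    {F₂ : (Fin n₂ → ℝ) → (Fin n₂ → ℝ) → ℝ}
    {f : (Fin n₁ → ℝ) → (Fin n₂ → ℝ) → ℝ}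
    (hF₁ : IsFinslerMetric U₁ F₁) (hF₂ : IsFinslerMetric U₂ F₂)
    (hf : ContDiffOn ℝ (⊤ : ℕ∞) (fun p : (Fin n₁ → ℝ) × (Fin n₂ → ℝ) => f p.1 p.2) (U₁ ×ˢ U₂))
    (hfpos : ∀ x ∈ U₁, ∀ u ∈ U₂, 0 < f x u)
 :
    ∀ x ∈ U₁, ∀ u ∈ U₂, ∀ (y : Fin n₁ → ℝ) (v : Fin n₂ → ℝ), y ≠ 0 → v ≠ 0 →
      (∀ k i j l : Fin n₁,
        berwald (twisted F₁ F₂ f) (Sum.inl k) (Sum.inl i) (Sum.inl j) (Sum.inl l)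
            (Sum.elim x u) (Sum.elim y v)
          = berwald F₁ k i j l x y
            + f x u * (∑ h, pdy i (pdy j (cartanUp2 F₁ k h l)) x y * pdx h f x u)
              * (F₂ u v)^2)
      ∧ (∀ (k i l : Fin n₁) (β : Fin n₂),
        berwald (twisted F₁ F₂ f) (Sum.inl k) (Sum.inl i) (Sum.inr β) (Sum.inl l)
            (Sum.elim x u) (Sum.elim y v)
          = 2 * f x u * (∑ h, pdy l (cartanUp2 F₁ k h i) x y * pdx h f x u)
            * lowerY F₂ β u v)
      ∧ (∀ (k l : Fin n₁) (α β : Fin n₂),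
        berwald (twisted F₁ F₂ f) (Sum.inl k) (Sum.inr α) (Sum.inr β) (Sum.inl l)
            (Sum.elim x u) (Sum.elim y v)
          = 2 * f x u * fTensor F₂ α β u v * (∑ h, cartanUp2 F₁ k h l x y * pdx h f x u))
      ∧ (∀ (k : Fin n₁) (α β μ : Fin n₂),
        berwald (twisted F₁ F₂ f) (Sum.inl k) (Sum.inr α) (Sum.inr β) (Sum.inr μ)
            (Sum.elim x u) (Sum.elim y v)
          = -(2 * f x u * cartan F₂ α β μ u v * (∑ h, gInv F₁ x y k h * pdx h f x u)))
      ∧ (∀ (γ : Fin n₂) (i : Fin n₁) (β μ : Fin n₂),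
        berwald (twisted F₁ F₂ f) (Sum.inr γ) (Sum.inl i) (Sum.inr β) (Sum.inr μ)
            (Sum.elim x u) (Sum.elim y v) = 0)
      ∧ (∀ (γ : Fin n₂) (i j : Fin n₁) (μ : Fin n₂),
        berwald (twisted F₁ F₂ f) (Sum.inr γ) (Sum.inl i) (Sum.inl j) (Sum.inr μ)
            (Sum.elim x u) (Sum.elim y v) = 0)
      ∧ (∀ (γ : Fin n₂) (i j k : Fin n₁),
        berwald (twisted F₁ F₂ f) (Sum.inr γ) (Sum.inl i) (Sum.inl j) (Sum.inl k)
            (Sum.elim x u) (Sum.elim y v) = 0)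
      ∧ (∀ γ α β μ : Fin n₂,
        berwald (twisted F₁ F₂ f) (Sum.inr γ) (Sum.inr α) (Sum.inr β) (Sum.inr μ)
            (Sum.elim x u) (Sum.elim y v)
          = berwald F₂ γ α β μ u v
            + (f x u)⁻¹ *
              ((∑ ν, pdy β (pdy α (cartanUp2 F₂ γ ν μ)) u v * pdy ν f x u) * (F₂ u v)^2
              + 2 * (∑ ν, pdy β (cartanUp2 F₂ γ ν α) u v * pdy ν f x u) * lowerY F₂ μ u v
              + 2 * (∑ ν, pdy μ (cartanUp2 F₂ γ ν α) u v * pdy ν f x u) * lowerY F₂ β u v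
              + 2 * (∑ ν, cartanUp2 F₂ γ ν α u v * pdy ν f x u) * fTensor F₂ μ β u v
              + 2 * (∑ ν, pdy β (cartanUp2 F₂ γ ν μ) u v * pdy ν f x u) * lowerY F₂ α u v
              + 2 * (∑ ν, cartanUp2 F₂ γ ν β u v * pdy ν f x u) * fTensor F₂ μ α u v
              + 2 * (∑ ν, cartanUp2 F₂ γ ν μ u v * pdy ν f x u) * fTensor F₂ α β u v
              - 2 * cartan F₂ α β μ u v * (∑ ν, gInv F₂ u v γ ν * pdy ν f x u))) := by
  intro x hx u hu y v hy hv
  have hX : (Sum.elim x u : Fin n₁ ⊕ Fin n₂ → ℝ) ∈ TW.SS U₁ U₂ := ⟨hx, hu⟩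
  have hY : (Sum.elim y v : Fin n₁ ⊕ Fin n₂ → ℝ) ∈ TW.SL n₁ n₂ := ⟨hy, hv⟩
  have hv' : v ∈ TW.slit (Fin n₂) := hv
  have hy' : y ∈ TW.slit (Fin n₁) := hy
  have hf0 : f x u ≠ 0 := (hfpos x hx u hu).ne'
  obtain ⟨hl, hr⟩ := TW.spray_tw hF₁ hF₂ hf hX (Sum.elim_comp_inl x u) (Sum.elim_comp_inr x u) hf0
  have o1 := TW.slit_open (κ := Fin n₁)
  have o2 := TW.slit_open (κ := Fin n₂)
  have sG1 := fun k => TW.sm_spray hF₁ hx k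
  have sG2 := fun k => TW.sm_spray hF₂ hu k
  have sL := TW.sm_Lf hF₂ hu
  have s1 : TW.Sm (TW.slit (Fin n₂)) (fun _ => (1:ℝ)) := TW.one_sm 1
  have s1' : TW.Sm (TW.slit (Fin n₁)) (fun _ => (1:ℝ)) := TW.one_sm 1
  have sI1 := fun k h => TW.sm_gI hF₁ hx k h
  have sI2 := fun k h => TW.sm_gI hF₂ hu k h
  have sP := fun k => TW.sm_lin (fun h => sI1 k h) (fun h => -(1/2) * f x u * pdx h f x u)
  have sP2 := fun k => TW.sm_lin (fun h => sI2 k h) (fun h => -(1/2) * (f x u)⁻¹ * pdy h f x u)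
  have sℓ : TW.Sm (TW.slit (Fin n₁)) (fun y => ∑ h, y h * ((f x u)⁻¹ * pdx h f x u)) :=
    TW.sm_lin (fun h => TW.sm_coord h) _
  have sℓ2 : TW.Sm (TW.slit (Fin n₂)) (fun y => ∑ h, y h * ((f x u)⁻¹ * pdy h f x u)) :=
    TW.sm_lin (fun h => TW.sm_coord h) _
  have sγ : ∀ γ, TW.Sm (TW.slit (Fin n₂)) (fun v => v γ) := fun γ => TW.sm_coord γ
  have sQ := fun γ => sℓ2.mul (sγ γ)
  have sR := fun γ => (sP2 γ).mul sL
  have sΨ := fun γ => (sG2 γ).add ((sQ γ).add (sR γ))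
  have Lv : (F₂ u v) ^ 2 = TW.Lq F₂ u v := rfl
  refine ⟨?_, ?_, ?_, ?_, ?_, ?_, ?_, ?_⟩
  · intro k i j l
    have e1 := TW.step_l o1 o2 (sG1 k) (sP k) s1 sL (hl k) l
    have e2 := TW.step_l o1 o2 ((sG1 k).D o1 l) ((sP k).D o1 l) s1 sL e1 j
    have e3 := TW.step_l o1 o2 (((sG1 k).D o1 l).D o1 j) (((sP k).D o1 l).D o1 j) s1 sL e2 i hY
    refine e3.trans ?_
    simp only [TW.tt, Sum.elim_comp_inl, Sum.elim_comp_inr]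
    rw [TW.D3_lin o1 (fun h => sI1 k h) _ i j l hy']
    simp only [TW.D3_gI hF₁ hx _ _ i j l hy', TW.sumc, mul_one, Lv]
    rfl
  · intro k i l β
    have e1 := TW.step_l o1 o2 (sG1 k) (sP k) s1 sL (hl k) l
    have e2 := TW.step_r o1 o2 ((sG1 k).D o1 l) ((sP k).D o1 l) s1 sL e1 β
    have e3 := TW.step_l o1 o2 ((sG1 k).D o1 l) ((sP k).D o1 l) (s1.D o2 β) (sL.D o2 β) e2 i hY
    refine e3.trans ?_
    simp only [TW.tt, Sum.elim_comp_inl, Sum.elim_comp_inr]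
    rw [TW.D2_lin o1 (fun h => sI1 k h) _ i l hy', TW.D_L hF₂ hu β hv', TW.D_const]
    simp only [TW.D2_gI' hF₁ hx _ _ i l hy', TW.sumc, mul_zero, zero_add]
    change f x u * (∑ h, pdy l (cartanUp2 F₁ k h i) x y * pdx h f x u) * _ = _
    ring
  · intro k l α β
    have e1 := TW.step_l o1 o2 (sG1 k) (sP k) s1 sL (hl k) l
    have e2 := TW.step_r o1 o2 ((sG1 k).D o1 l) ((sP k).D o1 l) s1 sL e1 β
    have e3 := TW.step_r o1 o2 ((sG1 k).D o1 l) ((sP k).D o1 l) (s1.D o2 β) (sL.D o2 β) e2 α hY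
    refine e3.trans ?_
    simp only [TW.tt, Sum.elim_comp_inl, Sum.elim_comp_inr]
    rw [TW.D_lin o1 (fun h => sI1 k h) _ l hy', TW.D2_L, TW.D_const, TW.D_const]
    simp only [TW.D_gI hF₁ hx _ _ l hy', TW.sumc, mul_zero, zero_add]
    ring
  · intro k α β μ
    have e1 := TW.step_r o1 o2 (sG1 k) (sP k) s1 sL (hl k) μ
    have e2 := TW.step_r o1 o2 (sG1 k) (sP k) (s1.D o2 μ) (sL.D o2 μ) e1 β
    have e3 := TW.step_r o1 o2 (sG1 k) (sP k) ((s1.D o2 μ).D o2 β) ((sL.D o2 μ).D o2 β) e2 α hY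
    refine e3.trans ?_
    simp only [TW.tt, Sum.elim_comp_inl, Sum.elim_comp_inr]
    rw [TW.D3_L hF₂ hu α β μ hv', TW.D_const, TW.D_const, TW.D_const]
    simp only [TW.sumc', mul_zero, zero_add]
    ring
  · intro γ i β μ
    have e1 := TW.step_r o1 o2 s1' sℓ (sΨ γ) (sγ γ) (hr γ) μ
    have e2 := TW.step_r o1 o2 s1' sℓ (TW.Sm.D o2 (sΨ γ) μ) ((sγ γ).D o2 μ) e1 β
    have e3 := TW.step_l o1 o2 s1' sℓ ((TW.Sm.D o2 (sΨ γ) μ).D o2 β) (((sγ γ).D o2 μ).D o2 β) e2 i hY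
    refine e3.trans ?_
    simp [TW.tt, TW.D_const, TW.D_coord]
  · intro γ i j μ
    have e1 := TW.step_r o1 o2 s1' sℓ (sΨ γ) (sγ γ) (hr γ) μ
    have e2 := TW.step_l o1 o2 s1' sℓ (TW.Sm.D o2 (sΨ γ) μ) ((sγ γ).D o2 μ) e1 j
    have e3 := TW.step_l o1 o2 (s1'.D o1 j) (sℓ.D o1 j) (TW.Sm.D o2 (sΨ γ) μ) ((sγ γ).D o2 μ) e2 i hY
    refine e3.trans ?_
    simp only [TW.tt, Sum.elim_comp_inl, Sum.elim_comp_inr]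
    rw [TW.D2_lin o1 (fun h => TW.sm_coord h) _ i j hy']
    simp [TW.D_const, TW.D_coord]
  · intro γ i j k
    have e1 := TW.step_l o1 o2 s1' sℓ (sΨ γ) (sγ γ) (hr γ) k
    have e2 := TW.step_l o1 o2 (s1'.D o1 k) (sℓ.D o1 k) (sΨ γ) (sγ γ) e1 j
    have e3 := TW.step_l o1 o2 ((s1'.D o1 k).D o1 j) ((sℓ.D o1 k).D o1 j) (sΨ γ) (sγ γ) e2 i hY
    refine e3.trans ?_
    simp only [TW.tt, Sum.elim_comp_inl, Sum.elim_comp_inr]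
    rw [TW.D3_lin o1 (fun h => TW.sm_coord h) _ i j k hy']
    simp [TW.D_const, TW.D_coord]
  · intro γ α β μ
    have e1 := TW.step_r o1 o2 s1' sℓ (sΨ γ) (sγ γ) (hr γ) μ
    have e2 := TW.step_r o1 o2 s1' sℓ (TW.Sm.D o2 (sΨ γ) μ) ((sγ γ).D o2 μ) e1 β
    have e3 := TW.step_r o1 o2 s1' sℓ ((TW.Sm.D o2 (sΨ γ) μ).D o2 β) (((sγ γ).D o2 μ).D o2 β) e2 α hY
    refine e3.trans ?_
    simp only [TW.tt, Sum.elim_comp_inl, Sum.elim_comp_inr]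
    rw [TW.D3_add o2 (sG2 γ) ((sQ γ).add (sR γ)) α β μ hv']
    simp only
    rw [TW.D3_add o2 (sQ γ) (sR γ) α β μ hv']
    simp only
    rw [TW.D3_quad _ γ α β μ hv', TW.D3_mul o2 (sP2 γ) sL α β μ hv']
    simp only
    have c3 : ∀ ν, TW.D α (TW.D β (cartanUp2 F₂ γ ν μ u)) v
        = TW.D β (TW.D α (cartanUp2 F₂ γ ν μ u)) v :=
      fun ν => TW.D_comm o2 (TW.sm_C2 hF₂ hu γ ν μ) α β hv'
    rw [TW.D3_lin o2 (fun h => sI2 γ h) _ α β μ hv', TW.D2_lin o2 (fun h => sI2 γ h) _ β μ hv',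
      TW.D2_lin o2 (fun h => sI2 γ h) _ α μ hv', TW.D2_lin o2 (fun h => sI2 γ h) _ α β hv',
      TW.D_lin o2 (fun h => sI2 γ h) _ α hv', TW.D_lin o2 (fun h => sI2 γ h) _ β hv',
      TW.D_lin o2 (fun h => sI2 γ h) _ μ hv', TW.D3_L hF₂ hu α β μ hv',
      TW.D_L hF₂ hu α hv', TW.D_L hF₂ hu β hv', TW.D_L hF₂ hu μ hv', TW.D2_L, TW.D2_L, TW.D2_L,
      TW.fT_symm hF₂ hu hv' α μ, TW.fT_symm hF₂ hu hv' β μ]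
    simp only [TW.D3_gI hF₂ hu _ _ α β μ hv', TW.D2_gI hF₂ hu _ _ β μ hv',
      TW.D2_gI' hF₂ hu _ _ α μ hv', TW.D2_gI' hF₂ hu _ _ α β hv', TW.D_gI hF₂ hu _ _ _ hv',
      TW.sumc, c3, TW.D_coord, TW.D_const, Lv]
    rw [TW.sumc']
    have b0 : TW.D α (TW.D β (TW.D μ (sprayCoef F₂ γ u))) v = berwald F₂ γ α β μ u v := rfl
    have p2 : ∀ ν, TW.D β (TW.D α (cartanUp2 F₂ γ ν μ u)) v
      = pdy β (pdy α (cartanUp2 F₂ γ ν μ)) u v := fun _ => rfl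
    have p1 : ∀ a b ν, TW.D a (cartanUp2 F₂ γ ν b u) v
      = pdy a (cartanUp2 F₂ γ ν b) u v := fun _ _ _ => rfl
    simp only [b0, p2, p1]
    ring
end
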